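/- arXiv:0710.5856 — 2 statements merged into one kernel-verified Lean document; each statement's English description precedes it below -/
import Mathlib

section
/- If the matrix with diagonal entries a_1,...,a_N and off-diagonal (i,j) entry 1/(λ_j - λ_i), where λ_1,...,λ_N are distinct real numbers, has all eigenvalues real, then the numbers a_1,...,a_N are all real. -/
open Matrix Polynomial

namespace CM

open Equiv

variable {N : ℕ} (L : Fin N → ℂ) (a : Fin N → ℂ)

/-- Function space on the symmetric group. -/
abbrev V (N : ℕ) := Perm (Fin N) → ℂ

/-- The Dunkl-type operators. -/
noncomputable def y (i : Fin N) : Module.End ℂ (V N) where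
  toFun f w := a (w i) * f w + ∑ j, (L (w i) - L (w j))⁻¹ * f (w * swap i j)
  map_add' f g := by
    funext w
    simp only [Pi.add_apply, mul_add, Finset.sum_add_distrib]
    ring
  map_smul' c f := by
    funext w
    simp only [Pi.smul_apply, smul_eq_mul, RingHom.id_apply, mul_add, Finset.mul_sum]
    congr 1
    · ring
    · exact Finset.sum_congr rfl fun _ _ => by ring

def x (i : Fin N) : Module.End ℂ (V N) where
  toFun f w := L (w i) * f w
  map_add' f g := by
    funext w
    simp only [Pi.add_apply, mul_add]
  map_smul' c f := by
    funext w
    simp only [Pi.smul_apply, smul_eq_mul, RingHom.id_apply]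
    ring

def s (σ : Perm (Fin N)) : Module.End ℂ (V N) where
  toFun f w := f (w * σ)
  map_add' f g := rfl
  map_smul' c f := rfl

lemma y_apply (i : Fin N) (f : V N) (w) :
    y L a i f w = a (w i) * f w + ∑ j, (L (w i) - L (w j))⁻¹ * f (w * swap i j) := rfl
lemma x_apply (i : Fin N) (f : V N) (w) : x L i f w = L (w i) * f w := rfl
lemma s_apply (σ : Perm (Fin N)) (f : V N) (w) : s σ f w = f (w * σ) := rfl

lemma mul_neg_end (A C : Module.End ℂ (V N)) : A * -C = -(A * C) :=
  LinearMap.ext fun f => by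
    rw [LinearMap.neg_apply, Module.End.mul_apply, Module.End.mul_apply, LinearMap.neg_apply,
      map_neg]

lemma neg_mul_end (A C : Module.End ℂ (V N)) : -A * C = -(A * C) :=
  LinearMap.ext fun f => by
    rw [LinearMap.neg_apply, Module.End.mul_apply, Module.End.mul_apply, LinearMap.neg_apply]

lemma s_y (σ : Perm (Fin N)) (i : Fin N) : s σ * y L a i = y L a (σ i) * s σ := by
  refine LinearMap.ext fun f => ?_
  funext w
  simp only [Module.End.mul_apply, s_apply, y_apply, Perm.mul_apply]
  congr 1
  rw [← Equiv.sum_comp σ (fun j => (L (w (σ i)) - L (w j))⁻¹ * f (w * swap (σ i) j * σ))]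
  refine Finset.sum_congr rfl fun j _ => ?_
  congr 2
  rw [mul_assoc, mul_assoc, Equiv.mul_swap_eq_swap_mul]

variable {L} (hL : Function.Injective L)

include hL

lemma comm_ne {i j : Fin N} (h : i ≠ j) :
    y L a i * x L j - x L j * y L a i = s (swap i j) := by
  refine LinearMap.ext fun f => ?_
  funext w
  simp only [Module.End.mul_apply, LinearMap.sub_apply, Pi.sub_apply, s_apply, y_apply, x_apply,
    Perm.mul_apply, mul_add, Finset.mul_sum]
  rw [add_sub_add_comm, ← Finset.sum_sub_distrib, Finset.sum_eq_single j]
  · have : L (w i) - L (w j) ≠ 0 := sub_ne_zero.2 fun e => h (w.injective (hL e))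
    rw [swap_apply_right]
    field_simp
    ring
  · intro l _ hl
    rw [swap_apply_of_ne_of_ne h.symm hl.symm]
    ring
  · simp

lemma comm_eq (i : Fin N) :
    y L a i * x L i - x L i * y L a i = - ∑ l ∈ Finset.univ.erase i, s (swap i l) := by
  refine LinearMap.ext fun f => ?_
  funext w
  simp only [Module.End.mul_apply, LinearMap.sub_apply, Pi.sub_apply, y_apply, x_apply,
    Perm.mul_apply, mul_add, Finset.mul_sum, LinearMap.neg_apply, Pi.neg_apply,
    LinearMap.sum_apply, Finset.sum_apply, s_apply]
  rw [add_sub_add_comm, ← Finset.sum_sub_distrib,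
    ← Finset.add_sum_erase _ _ (Finset.mem_univ i), ← Finset.sum_neg_distrib]
  have : ∀ l ∈ Finset.univ.erase i,
      (L (w i) - L (w l))⁻¹ * (L (w ((swap i l) i)) * f (w * swap i l)) -
        L (w i) * ((L (w i) - L (w l))⁻¹ * f (w * swap i l)) = - f (w * swap i l) := by
    intro l hl
    have : L (w i) - L (w l) ≠ 0 :=
      sub_ne_zero.2 fun e => (Finset.ne_of_mem_erase hl) (w.injective (hL e)).symm
    rw [swap_apply_left]
    field_simp
    ring
  rw [Finset.sum_congr rfl this]
  simp
  ring

lemma diag (A : Module.End ℂ (V N)) (hA : ∀ j, A * x L j = x L j * A) (f : V N) (w) :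
    A f w = f w * A 1 w := by
  have key : ∀ u, u ≠ w → A (Pi.single u 1) w = 0 := by
    intro u hu
    obtain ⟨j, hj⟩ : ∃ j, u j ≠ w j := by
      by_contra! h
      exact hu (Equiv.ext h)
    have h1 := congrFun (LinearMap.congr_fun (hA j) (Pi.single u 1)) w
    have h2 : x L j (Pi.single u 1) = L (u j) • (Pi.single u 1 : V N) := by
      funext v
      rw [x_apply]
      by_cases h : v = u
      · subst h; simp
      · simp [h]
    rw [Module.End.mul_apply, Module.End.mul_apply, h2, map_smul, x_apply, Pi.smul_apply,
      smul_eq_mul] at h1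
    have : (L (u j) - L (w j)) * A (Pi.single u 1) w = 0 := by linear_combination h1
    rcases mul_eq_zero.1 this with h | h
    · exact absurd (hL (sub_eq_zero.1 h)) hj
    · exact h
  have key2 : ∀ g : V N, A g w = g w * A (Pi.single w 1) w := by
    intro g
    have : g = ∑ u, g u • (Pi.single u 1 : V N) := by
      funext v
      simp [Finset.sum_apply, Pi.single_apply]
    conv_lhs => rw [this]
    rw [map_sum, Finset.sum_apply, Finset.sum_eq_single w]
    · simp
    · intro u _ hu
      simp [key u hu]
    · simp
  rw [key2 f, key2 1]
  simp

omit hL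

variable (L) in
/-- The transposed Calogero-Moser matrix. -/
noncomputable def B : Matrix (Fin N) (Fin N) ℂ :=
  Matrix.of fun l m => (if l = m then a l else 0) + (L l - L m)⁻¹

variable (L) in
lemma B_mulVec (g : Fin N → ℂ) (l) :
    (B L a *ᵥ g) l = a l * g l + ∑ m, (L l - L m)⁻¹ * g m := by
  simp [B, Matrix.mulVec, dotProduct, add_mul, Finset.sum_add_distrib]

lemma y_lift (i : Fin N) (g : Fin N → ℂ) :
    y L a i (fun w => g (w i)) = fun w => (B L a *ᵥ g) (w i) := by
  funext w
  rw [y_apply, B_mulVec]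
  congr 1
  rw [← Equiv.sum_comp w (fun m => (L (w i) - L m)⁻¹ * g m)]
  simp

lemma y_pow_lift (i : Fin N) (k : ℕ) :
    (y L a i ^ k) (1 : V N) = fun w => ((B L a ^ k) *ᵥ 1) (w i) := by
  induction k with
  | zero => funext w; simp
  | succ k ih =>
    rw [pow_succ', Module.End.mul_apply, ih, y_lift, pow_succ', Matrix.mulVec_mulVec]

include hL

lemma y_y_one {i k : Fin N} (h : i ≠ k) (w) :
    (y L a i * y L a k) 1 w =
      (B L a *ᵥ 1) (w i) * (B L a *ᵥ 1) (w k)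
        + (L (w i) - L (w k))⁻¹ * ((B L a *ᵥ 1) (w i) - (B L a *ᵥ 1) (w k)) := by
  have h1 := y_pow_lift (L := L) a k 1
  rw [pow_one, pow_one] at h1
  rw [Module.End.mul_apply, h1]
  have h2 : (B L a *ᵥ 1) (w i) = a (w i) + ∑ j, (L (w i) - L (w j))⁻¹ := by
    rw [B_mulVec, ← Equiv.sum_comp w]
    simp
  generalize B L a *ᵥ 1 = g at *
  rw [y_apply, ← Finset.add_sum_erase _ _ (Finset.mem_univ k)]
  rw [← Finset.add_sum_erase _ _ (Finset.mem_univ k)] at h2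
  have : ∀ j ∈ Finset.univ.erase k, (L (w i) - L (w j))⁻¹ * g ((w * swap i j) k)
      = (L (w i) - L (w j))⁻¹ * g (w k) := by
    intro j hj
    rw [Perm.mul_apply, swap_apply_of_ne_of_ne h.symm (Finset.ne_of_mem_erase hj).symm]
  rw [Finset.sum_congr rfl this, ← Finset.sum_mul, Perm.mul_apply, swap_apply_right]
  linear_combination -(g (w k)) * h2

lemma y_comm (i k : Fin N) : y L a i * y L a k = y L a k * y L a i := by
  by_cases h : i = k
  · rw [h]
  have hsy : ∀ σ m, y L a m * s σ = s σ * y L a (σ⁻¹ m) := by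
    intro σ m
    rw [s_y]; simp
  -- auxiliary computation
  have main : ∀ i k : Fin N, i ≠ k → 
      y L a i * (y L a k * x L k - x L k * y L a k) - (y L a k * x L k - x L k * y L a k) * y L a i
      = (y L a k * s (swap i k) - s (swap i k) * y L a k) := by
    intro i k h
    rw [comm_eq a hL k]
    have h0 : y L a i * (-∑ l ∈ Finset.univ.erase k, s (swap k l)) -
        (-∑ l ∈ Finset.univ.erase k, s (swap k l)) * y L a i
        = ∑ l ∈ Finset.univ.erase k, (s (swap k l) * y L a i - y L a i * s (swap k l)) := by
      rw [Finset.sum_sub_distrib, ← Finset.mul_sum, ← Finset.sum_mul]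
      simp only [mul_neg_end, neg_mul_end]
      abel
    rw [h0, Finset.sum_eq_single i]
    · rw [hsy, hsy, s_y, s_y]
      simp only [swap_inv, swap_apply_left, swap_apply_right, Equiv.swap_comm k i]
      rw [s_y, s_y]
      simp
    · intro l hl hli
      rw [s_y, swap_apply_of_ne_of_ne h hli.symm, sub_self]
    · intro hi
      exact absurd (Finset.mem_erase.2 ⟨h, Finset.mem_univ _⟩) hi
  have hcomm : ∀ j, (y L a i * y L a k - y L a k * y L a i) * x L j
      = x L j * (y L a i * y L a k - y L a k * y L a i) := by
    intro j
    have jac : (y L a i * y L a k - y L a k * y L a i) * x L j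
      - x L j * (y L a i * y L a k - y L a k * y L a i) =
      (y L a i * (y L a k * x L j - x L j * y L a k) - (y L a k * x L j - x L j * y L a k) * y L a i)
      - (y L a k * (y L a i * x L j - x L j * y L a i)
        - (y L a i * x L j - x L j * y L a i) * y L a k) := by
      simp only [sub_mul, mul_sub, mul_assoc]
      abel
    rw [← sub_eq_zero, jac]
    by_cases hjk : j = k
    · subst hjk
      rw [main i j h, comm_ne a hL h, sub_self]
    by_cases hji : j = i
    · subst hji
      rw [main k j (Ne.symm h), comm_ne a hL (Ne.symm h), sub_self]
    rw [comm_ne a hL (Ne.symm hjk), comm_ne a hL (Ne.symm hji), s_y, s_y,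
      swap_apply_of_ne_of_ne h (Ne.symm hji), swap_apply_of_ne_of_ne (Ne.symm h) (Ne.symm hjk)]
    simp
  rw [← sub_eq_zero]
  refine LinearMap.ext fun f => ?_
  funext w
  rw [diag hL _ hcomm f w, LinearMap.sub_apply, Pi.sub_apply, y_y_one a hL h,
    y_y_one a hL (Ne.symm h)]
  have : (L (w k) - L (w i))⁻¹ = - (L (w i) - L (w k))⁻¹ := by
    rw [← inv_neg, neg_sub]
  rw [this]
  simp
  ring_nf
  simp

lemma pow_comm (i j : Fin N) (k : ℕ) :
    y L a i ^ k * x L j - x L j * y L a i ^ k =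
      ∑ m ∈ Finset.range k, y L a i ^ m * (y L a i * x L j - x L j * y L a i)
        * y L a i ^ (k - 1 - m) := by
  induction k with
  | zero => simp
  | succ k ih =>
    rw [Finset.sum_range_succ]
    have : ∀ m ∈ Finset.range k, y L a i ^ m * (y L a i * x L j - x L j * y L a i)
        * y L a i ^ (k + 1 - 1 - m) = y L a i ^ m * (y L a i * x L j - x L j * y L a i)
        * y L a i ^ (k - 1 - m) * y L a i := by
      intro m hm
      rw [Finset.mem_range] at hm
      rw [mul_assoc _ _ (y L a i), ← pow_succ]
      congr 2
      omega
    rw [Finset.sum_congr rfl this, ← Finset.sum_mul, ← ih]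
    simp only [Nat.add_sub_cancel, Nat.sub_self, pow_zero, mul_one, pow_succ]
    simp only [sub_mul, mul_sub, mul_assoc]
    abel

lemma s_y_pow (σ : Perm (Fin N)) (i : Fin N) (m : ℕ) :
    s σ * y L a i ^ m = y L a (σ i) ^ m * s σ := by
  induction m with
  | zero => simp
  | succ m ih => rw [pow_succ, ← mul_assoc, ih, mul_assoc, s_y, ← mul_assoc, ← pow_succ]

lemma psum_comm (k : ℕ) (j : Fin N) :
    (∑ i, y L a i ^ k) * x L j = x L j * ∑ i, y L a i ^ k := by
  rw [← sub_eq_zero, Finset.sum_mul, Finset.mul_sum, ← Finset.sum_sub_distrib,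
    ← Finset.add_sum_erase _ _ (Finset.mem_univ j)]
  have h1 : ∀ i ∈ Finset.univ.erase j, y L a i ^ k * x L j - x L j * y L a i ^ k =
      ∑ m ∈ Finset.range k, y L a i ^ m * y L a j ^ (k - 1 - m) * s (swap j i) := by
    intro i hi
    rw [pow_comm a hL]
    refine Finset.sum_congr rfl fun m _ => ?_
    rw [comm_ne a hL (Finset.ne_of_mem_erase hi), mul_assoc, s_y_pow a hL, swap_apply_left,
      Equiv.swap_comm, mul_assoc]
  rw [Finset.sum_congr rfl h1, pow_comm a hL, comm_eq a hL]
  have h2 : ∑ m ∈ Finset.range k, y L a j ^ m * (-∑ l ∈ Finset.univ.erase j, s (swap j l))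
      * y L a j ^ (k - 1 - m) = - ∑ l ∈ Finset.univ.erase j, ∑ m ∈ Finset.range k,
        y L a l ^ m * y L a j ^ (k - 1 - m) * s (swap j l) := by
    rw [Finset.sum_comm, ← Finset.sum_neg_distrib (s := Finset.range k), ← Finset.sum_range_reflect]
    refine Finset.sum_congr rfl fun m hm => ?_
    rw [Finset.mem_range] at hm
    rw [mul_neg_end, neg_mul_end, Finset.mul_sum, Finset.sum_mul]
    congr 1
    refine Finset.sum_congr rfl fun l _ => ?_
    rw [mul_assoc, s_y_pow a hL, swap_apply_left, ← mul_assoc]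
    congr 1
    have : k - 1 - (k - 1 - m) = m := by omega
    rw [this]
    have hc : Commute (y L a j) (y L a l) := y_comm a hL j l
    exact (hc.pow_pow _ _)
  rw [h2]
  simp

lemma psum_apply (k : ℕ) (f : V N) :
    (∑ i, y L a i ^ k) f = (∑ l, ((B L a ^ k) *ᵥ 1) l) • f := by
  funext w
  rw [diag hL _ (psum_comm a hL k) f w, LinearMap.sum_apply, Finset.sum_apply]
  simp only [y_pow_lift]
  rw [Equiv.sum_comp w (fun l => ((B L a ^ k) *ᵥ 1) l), Pi.smul_apply, smul_eq_mul, mul_comm]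

lemma trace_pow (k : ℕ) : (B L a ^ k).trace = ∑ l, ((B L a ^ k) *ᵥ 1) l := by
  have h1 : Matrix.diagonal L * B L a - B L a * Matrix.diagonal L
      = Matrix.of (fun _ _ => (1 : ℂ)) - 1 := by
    ext i j
    simp only [Matrix.sub_apply, Matrix.diagonal_mul, Matrix.mul_diagonal, Matrix.of_apply, B]
    by_cases h : i = j
    · subst h; simp; ring
    · have : L i - L j ≠ 0 := sub_ne_zero.2 fun e => h (hL e)
      simp [h]
      field_simp
  have h2 : ((Matrix.diagonal L * B L a - B L a * Matrix.diagonal L) * B L a ^ k).trace = 0 := by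
    rw [sub_mul, Matrix.trace_sub, mul_assoc, ← pow_succ', mul_assoc, Matrix.trace_mul_comm (B L a),
      mul_assoc, ← pow_succ, sub_self]
  rw [h1, sub_mul, Matrix.trace_sub, one_mul, sub_eq_zero] at h2
  rw [← h2, Matrix.trace_mul_comm]
  simp [Matrix.trace, Matrix.mul_apply, Matrix.mulVec, dotProduct]

lemma joint (t : Finset (Fin N)) :
    ∃ ν : Fin N → ℂ, ∃ f : V N, f ≠ 0 ∧ ∀ i ∈ t, y L a i f = ν i • f := by
  classical
  induction t using Finset.induction_on with
  | empty => exact ⟨0, 1, one_ne_zero, by simp⟩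
  | insert k t hk ih =>
    obtain ⟨ν, f, hf, h⟩ := ih
    let E : Submodule ℂ (V N) := ⨅ i ∈ t, LinearMap.ker (y L a i - algebraMap ℂ _ (ν i))
    have hE : ∀ g, g ∈ E ↔ ∀ i ∈ t, y L a i g = ν i • g := by
      intro g
      simp [E, Submodule.mem_iInf, sub_eq_zero]
    have hmap : ∀ g ∈ E, y L a k g ∈ E := by
      intro g hg
      rw [hE] at hg ⊢
      intro i hi
      rw [← Module.End.mul_apply, y_comm a hL i k, Module.End.mul_apply, hg i hi, map_smul]
    haveI : Nontrivial E := ⟨⟨⟨f, (hE f).2 h⟩, 0, fun e => hf (congrArg Subtype.val e)⟩⟩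
    obtain ⟨μ, hμ⟩ := Module.End.exists_eigenvalue ((y L a k).restrict hmap)
    obtain ⟨g, hg⟩ := hμ.exists_hasEigenvector
    have hg1 : y L a k g.1 = μ • g.1 := congrArg Subtype.val hg.apply_eq_smul
    refine ⟨Function.update ν k μ, g.1, fun e => hg.2 (Subtype.ext e), ?_⟩
    intro i hi
    by_cases hik : i = k
    · subst hik; simpa using hg1
    · rw [Function.update_of_ne hik]
      exact (hE g.1).1 g.2 i (Finset.mem_of_mem_insert_of_ne hi hik)

lemma psum_eq {ν : Fin N → ℂ} {f : V N} (hf : f ≠ 0) (h : ∀ i, y L a i f = ν i • f)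
    (q : ℂ[X]) : ∑ i, q.eval (ν i) = (aeval (B L a) q).trace := by
  have hpow : ∀ k i, (y L a i ^ k) f = ν i ^ k • f := by
    intro k i
    induction k with
    | zero => simp
    | succ k ih => rw [pow_succ', Module.End.mul_apply, ih, map_smul, h, smul_smul, pow_succ]
  induction q using Polynomial.induction_on' with
  | add p q hp hq => simp [Finset.sum_add_distrib, hp, hq]
  | monomial k c =>
    have h1 := psum_apply a hL k f
    rw [LinearMap.sum_apply, Finset.sum_congr rfl (fun i _ => hpow k i), ← Finset.sum_smul] at h1
    have h2 := smul_left_injective ℂ hf h1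
    rw [← trace_pow a hL] at h2
    rw [aeval_monomial, Algebra.algebraMap_eq_smul_one, smul_mul_assoc, one_mul, Matrix.trace_smul,
      ← h2]
    simp [Finset.mul_sum]

lemma root {ν : Fin N → ℂ} {f : V N} (hf : f ≠ 0) (h : ∀ i, y L a i f = ν i • f) (i : Fin N) :
    (B L a).charpoly.IsRoot (ν i) := by
  classical
  by_contra hr
  let q : ℂ[X] := ∏ j ∈ Finset.univ.filter (fun j => ν j ≠ ν i), (X - C (ν j))
  have hq : q.eval (ν i) ≠ 0 := by
    simp only [q, eval_prod, eval_sub, eval_X, eval_C]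
    refine Finset.prod_ne_zero_iff.2 fun j hj => sub_ne_zero.2 ?_
    exact (Finset.mem_filter.1 hj).2.symm
  have hq2 : ∀ j, ν j ≠ ν i → q.eval (ν j) = 0 := by
    intro j hj
    simp only [q, eval_prod, eval_sub, eval_X, eval_C]
    exact Finset.prod_eq_zero (Finset.mem_filter.2 ⟨Finset.mem_univ j, hj⟩) (sub_self _)
  have h1 := psum_eq a hL hf h ((B L a).charpoly * q)
  rw [map_mul, Matrix.aeval_self_charpoly, zero_mul, Matrix.trace_zero] at h1
  have h2 : ∀ j ∈ Finset.univ, ((B L a).charpoly * q).eval (ν j)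
      = if ν j = ν i then ((B L a).charpoly * q).eval (ν i) else 0 := by
    intro j _
    split_ifs with hj
    · rw [hj]
    · rw [eval_mul, hq2 j hj, mul_zero]
  rw [Finset.sum_congr rfl h2, ← Finset.sum_filter, Finset.sum_const, nsmul_eq_mul, eval_mul] at h1
  rcases mul_eq_zero.1 h1 with h3 | h3
  · rw [Nat.cast_eq_zero, Finset.card_eq_zero] at h3
    have : i ∈ Finset.univ.filter (fun j => ν j = ν i) := by simp
    rw [h3] at this
    simp at this
  · exact (mul_ne_zero hr hq) h3

omit hL

lemma real_of_joint (lam : Fin N → ℝ) {ν : Fin N → ℝ} {f : V N} (hf : f ≠ 0)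
    (h : ∀ i, y (fun i => (lam i : ℂ)) a i f = (ν i : ℂ) • f) (k : Fin N) :
    (starRingEnd ℂ) (a k) = a k := by
  have h1 : ∀ w, a k * f w = (ν (w⁻¹ k) : ℂ) * f w
      - ∑ l, ((lam k : ℂ) - (lam l : ℂ))⁻¹ * f (swap k l * w) := by
    intro w
    have hww : w (w⁻¹ k) = k := w.apply_symm_apply k
    have := congrFun (h (w⁻¹ k)) w
    rw [y_apply, Pi.smul_apply, smul_eq_mul] at this
    rw [← this]
    simp only [hww]
    rw [← Equiv.sum_comp w (fun l => ((lam k : ℂ) - (lam l : ℂ))⁻¹ * f (swap k l * w))]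
    have : ∀ j, w * swap (w⁻¹ k) j = swap k (w j) * w := by
      intro j
      rw [Equiv.mul_swap_eq_swap_mul, hww]
    simp only [this]
    ring
  have hS : ∀ σ : Perm (Fin N), σ * σ = 1 →
      (starRingEnd ℂ) (∑ w, f (σ * w) * (starRingEnd ℂ) (f w))
        = ∑ w, f (σ * w) * (starRingEnd ℂ) (f w) := by
    intro σ hσ
    rw [map_sum, ← Equiv.sum_comp (Equiv.mulLeft σ)]
    refine Finset.sum_congr rfl fun w _ => ?_
    simp [← mul_assoc, hσ, mul_comm]
  have h2 : a k * ((∑ w, Complex.normSq (f w) : ℝ) : ℂ) =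
      ((∑ w, ν (w⁻¹ k) * Complex.normSq (f w) : ℝ) : ℂ)
      - ∑ l, (((lam k - lam l)⁻¹ : ℝ) : ℂ) * ∑ w, f (swap k l * w) * (starRingEnd ℂ) (f w) := by
    push_cast
    simp only [Finset.mul_sum]
    rw [Finset.sum_comm, ← Finset.sum_sub_distrib]
    refine Finset.sum_congr rfl fun w _ => ?_
    rw [← Complex.mul_conj, ← mul_assoc, h1 w, sub_mul, Finset.sum_mul, mul_assoc]
    simp only [mul_assoc]
  have h3 : (starRingEnd ℂ) (a k * ((∑ w, Complex.normSq (f w) : ℝ) : ℂ))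
      = a k * ((∑ w, Complex.normSq (f w) : ℝ) : ℂ) := by
    rw [h2, map_sub, Complex.conj_ofReal, map_sum]
    congr 1
    refine Finset.sum_congr rfl fun l _ => ?_
    rw [map_mul, Complex.conj_ofReal, hS _ (swap_mul_self _ _)]
  rw [map_mul, Complex.conj_ofReal] at h3
  refine mul_right_cancel₀ ?_ h3
  obtain ⟨w, hw⟩ := Function.ne_iff.1 hf
  have : 0 < ∑ w, Complex.normSq (f w) :=
    Finset.sum_pos' (fun _ _ => Complex.normSq_nonneg _)
      ⟨w, Finset.mem_univ _, Complex.normSq_pos.2 hw⟩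
  exact_mod_cast this.ne'

end CM

/-- If the matrix with diagonal entries `a i` and off-diagonal `(i,j)` entry
`1/(λ j - λ i)`, where the `λ i` are distinct real numbers, has all eigenvalues
real, then all the `a i` are real. -/
theorem stmt_0 (N : ℕ) (hN : 2 ≤ N) (lam : Fin N → ℝ) (hlam : Function.Injective lam)
    (a : Fin N → ℂ)
    (Z : Matrix (Fin N) (Fin N) ℂ)
    (hZ : ∀ i j, Z i j = if i = j then a i else 1 / ((lam j : ℂ) - (lam i : ℂ)))
    (heig : ∀ μ : ℂ, (Matrix.charpoly Z).IsRoot μ → ∃ r : ℝ, μ = (r : ℂ)) :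
    ∀ i, ∃ r : ℝ, a i = (r : ℂ) := by
  have hL : Function.Injective (fun i => (lam i : ℂ)) :=
    fun i j h => hlam (Complex.ofReal_injective h)
  have hB : CM.B (fun i => (lam i : ℂ)) a = Zᵀ := by
    ext i j
    rw [Matrix.transpose_apply, hZ]
    by_cases h : i = j
    · subst h; simp [CM.B]
    · simp [CM.B, h, Ne.symm h]
  obtain ⟨ν, f, hf, h⟩ := CM.joint a hL Finset.univ
  have h' : ∀ i, CM.y (fun i => (lam i : ℂ)) a i f = ν i • f := fun i => h i (Finset.mem_univ i)
  have hr : ∀ i, ∃ r : ℝ, ν i = (r : ℂ) := by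
    intro i
    apply heig
    have := CM.root a hL hf h' i
    rwa [hB, Matrix.charpoly_transpose] at this
  choose r hr using hr
  intro k
  have := CM.real_of_joint a lam (ν := r) hf (fun i => by rw [h' i, hr i]) k
  obtain ⟨t, ht⟩ := Complex.conj_eq_iff_real.1 this
  exact ⟨t, ht⟩
end

section
/- If Q and Z are complex N×N matrices with [Q,Z] = 1 - K for a rank-one matrix K, and all eigenvalues of Q and of Z are real, then there exists an invertible complex matrix C such that C⁻¹QC and C⁻¹ZC both have real entries. -/
open Matrix

set_option linter.unusedSectionVars false
namespace CM
open Polynomial Finset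

variable {ι : Type} [Fintype ι] [DecidableEq ι]

/-- The Calogero-Moser matrix. -/
noncomputable def Zmat (q p : ι → ℂ) : Matrix ι ι ℂ :=
  Matrix.diagonal p - Matrix.of (fun k l => (q k - q l)⁻¹)

lemma Zmat_mulVec (q p x : ι → ℂ) (k : ι) :
    (Zmat q p *ᵥ x) k = p k * x k - ∑ l, (q k - q l)⁻¹ * x l := by
  simp [Zmat, Matrix.mulVec, dotProduct, Matrix.diagonal_apply, sub_mul]

lemma interp (q p : ι → ℂ) (hq : Function.Injective q) (z a u : ℂ) (b : ℂ[X])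
    (hdeg : (b - C a * Lagrange.nodal univ q).degree < Fintype.card ι)
    (hb : ∀ k, b.derivative.eval (q k) =
      (p k - z + ∑ l, (q k - q l)⁻¹) * b.eval (q k))
    (hz : (z • (1 : Matrix ι ι ℂ) - Zmat q p).det ≠ 0) (hu : ∀ k, u ≠ q k) :
    b.eval u = a * (∏ j, (u - q j)) *
      (1 - (1 : ι → ℂ) ⬝ᵥ (((u • (1 : Matrix ι ι ℂ) - Matrix.diagonal q)⁻¹ *
        (z • (1 : Matrix ι ι ℂ) - Zmat q p)⁻¹) *ᵥ 1)) := by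
  set π : ι → ℂ := fun k => eval (q k) (Lagrange.nodal (univ.erase k) q) with hπ
  have hπ0 : ∀ k, π k ≠ 0 := by
    intro k
    simp only [hπ, Lagrange.eval_nodal]
    refine prod_ne_zero_iff.2 fun j hj => sub_ne_zero.2 fun h => ?_
    exact (mem_erase.1 hj).1 (hq h).symm
  set x : ι → ℂ := fun k => b.eval (q k) / π k with hx
  have hbx : ∀ k, b.eval (q k) = x k * π k := fun k => by
    simp only [hx]; rw [div_mul_cancel₀ _ (hπ0 k)]
  have hbeq : b = C a * Lagrange.nodal univ q +
      ∑ k, C (x k) * Lagrange.nodal (univ.erase k) q := by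
    apply Polynomial.eq_of_degree_sub_lt_of_eval_index_eq (s := univ) (v := q) hq.injOn
    · rw [← sub_sub]
      refine lt_of_le_of_lt (degree_sub_le _ _) (max_lt (by simpa using hdeg) ?_)
      refine lt_of_le_of_lt (degree_sum_le _ _) ?_
      rw [Finset.sup_lt_iff (by exact WithBot.bot_lt_coe _)]
      intro k _
      rw [← smul_eq_C_mul]
      refine lt_of_le_of_lt (degree_smul_le _ _) ?_
      rw [Lagrange.degree_nodal]
      exact_mod_cast card_erase_lt_of_mem (mem_univ k)
    · intro k _
      simp only [eval_add, eval_mul, eval_C, eval_finsetSum,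
        Lagrange.eval_nodal_at_node (mem_univ k), mul_zero, zero_add]
      rw [Finset.sum_eq_single k, hbx k]
      · intro l _ hl
        rw [Lagrange.eval_nodal_at_node (mem_erase.2 ⟨hl.symm, mem_univ _⟩), mul_zero]
      · simp
  have hder : ∀ k, b.derivative.eval (q k) = a * π k + x k * (π k * ∑ l, (q k - q l)⁻¹)
      + ∑ l, x l * π k * (q k - q l)⁻¹ := by
    intro k
    have hnod : ∀ l, l ≠ k → eval (q k) (derivative (Lagrange.nodal (univ.erase l) q))
        = π k * (q k - q l)⁻¹ := by
      intro l hl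
      rw [Lagrange.eval_nodal_derivative_eval_node_eq (mem_erase.2 ⟨hl.symm, mem_univ _⟩)]
      have h0 : q k - q l ≠ 0 := sub_ne_zero.2 fun h => hl (hq h).symm
      rw [eq_mul_inv_iff_mul_eq₀ h0]
      simp only [hπ]
      rw [Lagrange.nodal_eq_mul_nodal_erase (s := univ.erase k) (i := l) (by simp [hl]),
        Finset.erase_right_comm]
      simp [mul_comm]
    have hself : eval (q k) (derivative (Lagrange.nodal (univ.erase k) q))
        = π k * ∑ l, (q k - q l)⁻¹ := by
      rw [Lagrange.derivative_nodal, eval_finsetSum, mul_sum,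
        ← Finset.add_sum_erase univ _ (mem_univ k)]
      simp only [sub_self, _root_.inv_zero, mul_zero, zero_add]
      refine sum_congr rfl fun l hl => ?_
      have h0 : q k - q l ≠ 0 := sub_ne_zero.2 fun h => (mem_erase.1 hl).1 (hq h).symm
      rw [eq_mul_inv_iff_mul_eq₀ h0]
      simp only [hπ]
      rw [Lagrange.nodal_eq_mul_nodal_erase hl]
      simp [mul_comm]
    conv_lhs => rw [hbeq]
    simp only [derivative_add, derivative_mul, derivative_C, zero_mul, zero_add, eval_add,
      eval_mul, eval_C, derivative_sum, eval_finsetSum]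
    rw [Lagrange.eval_nodal_derivative_eval_node_eq (mem_univ k), add_assoc]
    congr 1
    rw [← Finset.add_sum_erase univ _ (mem_univ k), hself,
      ← Finset.add_sum_erase univ (fun l => x l * π k * (q k - q l)⁻¹) (mem_univ k)]
    simp only [sub_self, _root_.inv_zero, mul_zero, zero_add]
    congr 1
    refine sum_congr rfl fun l hl => ?_
    rw [hnod l (mem_erase.1 hl).1]; ring
  have hsys : (z • (1 : Matrix ι ι ℂ) - Zmat q p) *ᵥ x = -a • (1 : ι → ℂ) := by
    ext k
    rw [Matrix.sub_mulVec, Pi.sub_apply, Zmat_mulVec]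
    have h1 := hb k
    rw [hder k, hbx k] at h1
    have h2 : ∑ l, x l * π k * (q k - q l)⁻¹ = π k * ∑ l, (q k - q l)⁻¹ * x l := by
      rw [mul_sum]; exact sum_congr rfl fun l _ => by ring
    rw [h2] at h1
    simp only [Matrix.smul_mulVec, Matrix.one_mulVec, Pi.smul_apply, smul_eq_mul, Pi.one_apply]
    apply mul_left_cancel₀ (hπ0 k)
    linear_combination h1
  have hxs : x = -a • ((z • (1 : Matrix ι ι ℂ) - Zmat q p)⁻¹ *ᵥ 1) := by
    rw [← Matrix.mulVec_smul, ← hsys, Matrix.mulVec_mulVec,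
      Matrix.nonsing_inv_mul _ (isUnit_iff_ne_zero.2 hz), Matrix.one_mulVec]
  have hinv : (u • (1 : Matrix ι ι ℂ) - Matrix.diagonal q)⁻¹ =
      Matrix.diagonal (fun k => (u - q k)⁻¹) := by
    apply Matrix.inv_eq_right_inv
    rw [Matrix.smul_one_eq_diagonal, Matrix.diagonal_sub, Matrix.diagonal_mul_diagonal,
      ← Matrix.diagonal_one]
    congr 1
    ext k
    exact mul_inv_cancel₀ (sub_ne_zero.2 (hu k))
  have hfin : a * ((1 : ι → ℂ) ⬝ᵥ (((u • (1 : Matrix ι ι ℂ) - Matrix.diagonal q)⁻¹ *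
        (z • (1 : Matrix ι ι ℂ) - Zmat q p)⁻¹) *ᵥ 1)) = - ∑ k, (u - q k)⁻¹ * x k := by
    rw [← Matrix.mulVec_mulVec, hinv, hxs]
    simp only [dotProduct, Pi.one_apply, one_mul, Matrix.mulVec_diagonal, Pi.smul_apply,
      smul_eq_mul, mul_sum, ← Finset.sum_neg_distrib]
    exact sum_congr rfl fun k _ => by ring
  rw [mul_sub, mul_one, mul_right_comm a (∏ j, (u - q j)), hfin]
  conv_lhs => rw [hbeq]
  simp only [eval_add, eval_mul, eval_C, eval_finsetSum, Lagrange.eval_nodal]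
  rw [neg_mul, sub_neg_eq_add, sum_mul]
  congr 1
  refine sum_congr rfl fun k _ => ?_
  rw [← Finset.mul_prod_erase univ _ (mem_univ k)]
  have := sub_ne_zero.2 (hu k)
  field_simp


/-- The (symmetric) operator whose eigenvalues encode the pair of matrices. -/
noncomputable def Bop (q μ : ι → ℂ) (u z : ℂ) (φ : Equiv.Perm ι → ℂ) (σ : Equiv.Perm ι) : ℂ :=
  ∑ τ : Equiv.Perm ι, ((Equiv.Perm.sign τ : ℤ) : ℂ) * φ (τ * σ) *
    ∏ k, if τ k = k then 1 - (u - q k) * (z - μ (σ.symm k)) else 1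

noncomputable def facP (q m : ι → ℂ) (z : ℂ) (τ : Equiv.Perm ι) (k : ι) : ℂ[X] :=
  if τ k = k then 1 - (X - C (q k)) * C (z - m k) else 1

noncomputable def Bpoly (q m : ι → ℂ) (z : ℂ) (ψ : Equiv.Perm ι → ℂ) : ℂ[X] :=
  ∑ τ : Equiv.Perm ι, C (((Equiv.Perm.sign τ : ℤ) : ℂ) * ψ τ) * ∏ k, facP q m z τ k

lemma facP_eval (q m : ι → ℂ) (u z : ℂ) (τ : Equiv.Perm ι) (k : ι) :
    (facP q m z τ k).eval u = if τ k = k then 1 - (u - q k) * (z - m k) else 1 := by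
  unfold facP; split_ifs <;> simp

lemma Bpoly_eval (q μ : ι → ℂ) (u z : ℂ) (φ : Equiv.Perm ι → ℂ) (σ : Equiv.Perm ι) :
    (Bpoly q (fun k => μ (σ.symm k)) z (fun τ => φ (τ * σ))).eval u = Bop q μ u z φ σ := by
  simp [Bpoly, Bop, eval_finsetSum, eval_prod, facP_eval]

lemma facP_natDegree (q m : ι → ℂ) (z : ℂ) (τ : Equiv.Perm ι) (k : ι) :
    (facP q m z τ k).natDegree ≤ 1 := by
  unfold facP
  split_ifs
  · compute_degree
  · simp

lemma facP_coeff (q m : ι → ℂ) (z : ℂ) (τ : Equiv.Perm ι) (k : ι) :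
    (facP q m z τ k).coeff 1 = if τ k = k then -(z - m k) else 0 := by
  unfold facP
  split_ifs
  · rw [coeff_sub, coeff_mul_C]
    simp [coeff_one]
  · simp [coeff_one]

lemma facP_derivative (q m : ι → ℂ) (z : ℂ) (τ : Equiv.Perm ι) (k : ι) :
    (facP q m z τ k).derivative = C (if τ k = k then -(z - m k) else 0) := by
  unfold facP
  split_ifs
  · simp
  · simp

lemma Bpoly_degree (q m : ι → ℂ) (z : ℂ) (ψ : Equiv.Perm ι → ℂ) :
    (Bpoly q m z ψ - C ((-1) ^ Fintype.card ι * (∏ k, (z - m k)) * ψ 1) *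
      Lagrange.nodal univ q).degree < Fintype.card ι := by
  rw [degree_lt_iff_coeff_zero]
  intro n hn
  have hd : ∀ τ, (∏ k, facP q m z τ k).natDegree ≤ Fintype.card ι := by
    intro τ
    refine (natDegree_prod_le _ _).trans ?_
    refine (Finset.sum_le_card_nsmul _ _ 1 fun k _ => facP_natDegree q m z τ k).trans ?_
    simp
  have hc : ∀ τ, (∏ k, facP q m z τ k).coeff (Fintype.card ι) =
      if τ = 1 then (-1) ^ Fintype.card ι * (∏ k, (z - m k)) else 0 := by
    intro τ
    have := coeff_prod_of_natDegree_le (s := univ) (f := fun k => facP q m z τ k) (n := 1)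
      (fun k _ => facP_natDegree q m z τ k)
    rw [mul_one, Finset.card_univ] at this
    rw [this]
    split_ifs with h
    · subst h
      simp only [facP_coeff, Equiv.Perm.one_apply, if_true]
      rw [Finset.prod_neg, Finset.card_univ]
    · have : ∃ k, τ k ≠ k := by
        by_contra! h'
        exact h (Equiv.ext h')
      obtain ⟨k, hk⟩ := this
      refine Finset.prod_eq_zero (mem_univ k) ?_
      rw [facP_coeff, if_neg hk]
  rcases hn.eq_or_lt with h | h
  · subst h
    rw [coeff_sub, coeff_C_mul, Bpoly, finsetSum_coeff]
    simp only [coeff_C_mul, hc]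
    have hnod : (Lagrange.nodal univ q).coeff (Fintype.card ι) = 1 := by
      have := Lagrange.nodal_monic (s := univ) (v := q)
      rw [Monic, leadingCoeff, Lagrange.natDegree_nodal, Finset.card_univ] at this
      exact this
    rw [hnod]
    simp [mul_comm]
  · rw [coeff_sub, coeff_C_mul, Bpoly, finsetSum_coeff]
    simp only [coeff_C_mul]
    have hnod : (Lagrange.nodal univ q).coeff n = 0 := by
      apply coeff_eq_zero_of_natDegree_lt
      rw [Lagrange.natDegree_nodal, Finset.card_univ]; exact h
    rw [hnod, mul_zero, sub_zero]
    refine sum_eq_zero fun τ _ => ?_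
    rw [coeff_eq_zero_of_natDegree_lt ((hd τ).trans_lt h), mul_zero]

lemma key_tau (q m : ι → ℂ) (hq : Function.Injective q) (z : ℂ) (k l : ι) (τ : Equiv.Perm ι)
    (fac : Equiv.Perm ι → ι → ℂ)
    (hfac : ∀ τ j, fac τ j = if τ j = j then 1 - (q k - q j) * (z - m j) else 1) :
    (q k - q l)⁻¹ * (∏ j, fac τ j - ∏ j, fac (Equiv.swap k l * τ) j) =
      (if τ l = l then -(z - m l) else 0) * ∏ j ∈ univ.erase l, fac τ j
      + (if τ l = k then (z - m l) else 0) * ∏ j, fac τ j := by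
  have hk : ∀ τ, fac τ k = 1 := by intro τ; rw [hfac]; simp
  by_cases hlk : l = k
  · subst hlk
    have : ∏ j, fac τ j = ∏ j ∈ univ.erase l, fac τ j := by
      rw [← Finset.mul_prod_erase univ _ (mem_univ l), hk, one_mul]
    rw [this]
    simp only [sub_self, _root_.inv_zero, zero_mul]
    split_ifs <;> ring
  · have h0 : q k - q l ≠ 0 := sub_ne_zero.2 fun h => hlk (hq h).symm
    have hR : ∏ j ∈ univ.erase l, fac (Equiv.swap k l * τ) j = ∏ j ∈ univ.erase l, fac τ j := by
      refine prod_congr rfl fun j hj => ?_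
      by_cases hjk : j = k
      · subst hjk; rw [hk, hk]
      · rw [hfac, hfac]
        have hjl := (mem_erase.1 hj).1
        have : (Equiv.swap k l * τ) j = j ↔ τ j = j := by
          rw [Equiv.Perm.mul_apply, Equiv.swap_apply_eq_iff, Equiv.swap_apply_of_ne_of_ne hjk hjl]
        simp only [this]
    have hl : fac (Equiv.swap k l * τ) l = if τ l = k then 1 - (q k - q l) * (z - m l) else 1 := by
      rw [hfac]
      have : (Equiv.swap k l * τ) l = l ↔ τ l = k := by
        rw [Equiv.Perm.mul_apply, Equiv.swap_apply_eq_iff, Equiv.swap_apply_right]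
      simp only [this]
    rw [← Finset.mul_prod_erase univ (fac τ) (mem_univ l),
      ← Finset.mul_prod_erase univ (fac (Equiv.swap k l * τ)) (mem_univ l), hR, hl, hfac τ l]
    generalize ∏ j ∈ univ.erase l, fac τ j = R
    by_cases h1 : τ l = l
    · have h2 : τ l ≠ k := by rw [h1]; exact hlk
      simp only [if_pos h1, if_neg h2]
      field_simp; ring
    · by_cases h2 : τ l = k
      · simp only [if_neg h1, if_pos h2]
        field_simp; ring
      · simp only [if_neg h1, if_neg h2]; ring

lemma key_identity (q m p : ι → ℂ) (hq : Function.Injective q) (z : ℂ) (ψ : Equiv.Perm ι → ℂ)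
    (k : ι)
    (hψ : ∀ τ, p k * ψ τ = m (τ.symm k) * ψ τ +
      ∑ l, (q k - q l)⁻¹ * ψ (Equiv.swap k l * τ)) :
    (Bpoly q m z ψ).derivative.eval (q k) =
      (p k - z + ∑ l, (q k - q l)⁻¹) * (Bpoly q m z ψ).eval (q k) := by
  set fac : Equiv.Perm ι → ι → ℂ := fun τ j => (facP q m z τ j).eval (q k) with hfacdef
  have hfac : ∀ τ j, fac τ j = if τ j = j then 1 - (q k - q j) * (z - m j) else 1 :=
    fun τ j => facP_eval q m (q k) z τ j
  set s : Equiv.Perm ι → ℂ := fun τ => ((Equiv.Perm.sign τ : ℤ) : ℂ) with hs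
  have hL : (Bpoly q m z ψ).derivative.eval (q k) = ∑ τ, s τ * ψ τ *
      ∑ i, (if τ i = i then -(z - m i) else 0) * ∏ j ∈ univ.erase i, fac τ j := by
    simp only [Bpoly, derivative_sum, derivative_C_mul, eval_finsetSum, eval_mul, eval_C,
      derivative_prod_finset, facP_derivative, eval_prod]
    refine sum_congr rfl fun τ _ => ?_
    congr 1
    exact sum_congr rfl fun i _ => mul_comm _ _
  have hR : (Bpoly q m z ψ).eval (q k) = ∑ τ, s τ * ψ τ * ∏ j, fac τ j := by
    simp only [Bpoly, eval_finsetSum, eval_mul, eval_C, eval_prod, hs, hfacdef]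
  have hswap : ∀ l, ∑ τ, s τ * ((q k - q l)⁻¹ * ψ (Equiv.swap k l * τ)) * ∏ j, fac τ j =
      - ∑ τ, s τ * ψ τ * ((q k - q l)⁻¹ * ∏ j, fac (Equiv.swap k l * τ) j) := by
    intro l
    by_cases hlk : k = l
    · subst hlk; simp
    · rw [← Finset.sum_neg_distrib, ← Equiv.sum_comp (Equiv.mulLeft (Equiv.swap k l))]
      refine sum_congr rfl fun τ _ => ?_
      simp only [Equiv.coe_mulLeft, Equiv.swap_mul_self_mul, hs, Equiv.Perm.sign_mul,
        Equiv.Perm.sign_swap hlk]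
      push_cast
      ring
  have e1 : (p k - z + ∑ l, (q k - q l)⁻¹) * (Bpoly q m z ψ).eval (q k) =
      ∑ τ, s τ * ψ τ * ((m (τ.symm k) - z) * ∏ j, fac τ j)
      + ∑ l, ∑ τ, s τ * ((q k - q l)⁻¹ * ψ (Equiv.swap k l * τ)) * ∏ j, fac τ j
      + ∑ l, ∑ τ, s τ * ψ τ * ((q k - q l)⁻¹ * ∏ j, fac τ j) := by
    rw [hR, mul_sum, sum_comm (s := univ (α := ι)), sum_comm (s := univ (α := ι)),
      ← sum_add_distrib, ← sum_add_distrib]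
    refine sum_congr rfl fun τ _ => ?_
    rw [← sum_mul, ← mul_sum, ← mul_sum, ← sum_mul]
    have := hψ τ
    linear_combination (s τ * ∏ j, fac τ j) * this
  rw [e1, hL]
  simp only [hswap]
  rw [Finset.sum_neg_distrib, add_assoc, neg_add_eq_sub, ← sum_sub_distrib]
  simp only [← sum_sub_distrib, ← mul_sub]
  simp only [key_tau q m hq z k _ _ fac hfac]
  rw [sum_comm (s := univ (α := ι)), ← sum_add_distrib]
  refine sum_congr rfl fun τ _ => ?_
  rw [← mul_sum, ← mul_add]
  congr 1
  rw [sum_add_distrib, ← sum_mul (f := fun l => if τ l = k then z - m l else 0)]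
  have : ∑ l, (if τ l = k then z - m l else 0) = z - m (τ.symm k) := by
    have : ∀ l, (τ l = k) ↔ (l = τ.symm k) := fun l => by
      rw [Equiv.eq_symm_apply]
    simp [this]
  rw [this]; ring

/-- The spectral identity for an eigenfunction. -/
lemma Bop_eigen (q μ p : ι → ℂ) (hq : Function.Injective q) (φ : Equiv.Perm ι → ℂ)
    (hφ : ∀ k σ, p k * φ σ = μ (σ.symm k) * φ σ +
      ∑ l, (q k - q l)⁻¹ * φ (Equiv.swap k l * σ)) (u z : ℂ)
    (hz : (z • (1 : Matrix ι ι ℂ) - Zmat q p).det ≠ 0) (hu : ∀ k, u ≠ q k) (σ : Equiv.Perm ι) :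
    Bop q μ u z φ σ = ((-1) ^ Fintype.card ι * (∏ i, (z - μ i)) * (∏ j, (u - q j)) *
      (1 - (1 : ι → ℂ) ⬝ᵥ (((u • (1 : Matrix ι ι ℂ) - Matrix.diagonal q)⁻¹ *
        (z • (1 : Matrix ι ι ℂ) - Zmat q p)⁻¹) *ᵥ 1))) * φ σ := by
  rw [← Bpoly_eval]
  rw [interp q p hq z _ u _ (Bpoly_degree q _ z _) _ hz hu]
  · have : ∏ k, (z - μ (σ.symm k)) = ∏ i, (z - μ i) :=
      Equiv.prod_comp σ.symm (fun i => z - μ i)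
    rw [this, one_mul]
    ring
  · intro k
    apply key_identity q _ p hq z _ k
    intro τ
    have := hφ k (τ * σ)
    rw [this]
    simp only [mul_assoc]
    rfl


/-- Exchange operators. -/
noncomputable def Xop (q : ι → ℂ) (i m : ι) : Module.End ℂ (Equiv.Perm ι → ℂ) where
  toFun φ σ := (q (σ i) - q (σ m))⁻¹ * φ (σ * Equiv.swap i m)
  map_add' φ ψ := by ext σ; simp [mul_add]
  map_smul' c φ := by ext σ; simp; ring

noncomputable def Pop (p : ι → ℂ) (i : ι) : Module.End ℂ (Equiv.Perm ι → ℂ) where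
  toFun φ σ := p (σ i) * φ σ
  map_add' φ ψ := by ext σ; simp [mul_add]
  map_smul' c φ := by ext σ; simp; ring

lemma Xop_apply (q : ι → ℂ) (i m : ι) (φ : Equiv.Perm ι → ℂ) (σ : Equiv.Perm ι) :
    Xop q i m φ σ = (q (σ i) - q (σ m))⁻¹ * φ (σ * Equiv.swap i m) := rfl

lemma Pop_apply (p : ι → ℂ) (i : ι) (φ : Equiv.Perm ι → ℂ) (σ : Equiv.Perm ι) :
    Pop p i φ σ = p (σ i) * φ σ := rfl

/-- Dunkl operators. -/
noncomputable def Yop (q p : ι → ℂ) (i : ι) : Module.End ℂ (Equiv.Perm ι → ℂ) :=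
  Pop p i - ∑ m, Xop q i m

lemma Xop_self (q : ι → ℂ) (i : ι) : Xop q i i = 0 := by
  ext φ σ; simp [Xop_apply]

lemma Xop_neg (q : ι → ℂ) (i j : ι) : Xop q j i = - Xop q i j := by
  apply LinearMap.ext; intro φ; ext σ
  rw [LinearMap.neg_apply, Pi.neg_apply, Xop_apply, Xop_apply, Equiv.swap_comm, ← neg_sub, inv_neg,
    neg_mul]

lemma Pop_mul_Xop (q p : ι → ℂ) (i j : ι) : Pop p i * Xop q i j = Xop q i j * Pop p j := by
  apply LinearMap.ext; intro φ; ext σ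
  simp [Xop_apply, Pop_apply]; ring

lemma Pop_Xop_comm (q p : ι → ℂ) (i j m : ι) (h1 : i ≠ j) (h2 : i ≠ m) :
    Pop p i * Xop q j m = Xop q j m * Pop p i := by
  apply LinearMap.ext; intro φ; ext σ
  simp [Xop_apply, Pop_apply, Equiv.swap_apply_of_ne_of_ne h1 h2]; ring

lemma Pop_comm (p : ι → ℂ) (i j : ι) : Pop p i * Pop p j = Pop p j * Pop p i := by
  apply LinearMap.ext; intro φ; ext σ
  simp [Pop_apply]; ring

lemma Xop_comm (q : ι → ℂ) (i m j n : ι) (h1 : i ≠ j) (h2 : i ≠ n) (h3 : m ≠ j) (h4 : m ≠ n) :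
    Xop q i m * Xop q j n = Xop q j n * Xop q i m := by
  apply LinearMap.ext; intro φ; ext σ
  have : Equiv.swap i m * Equiv.swap j n = Equiv.swap j n * Equiv.swap i m := by
    ext x
    simp only [Equiv.Perm.mul_apply, Equiv.swap_apply_def]
    split_ifs <;> simp_all
  simp [Xop_apply, Equiv.swap_apply_of_ne_of_ne h1 h2, Equiv.swap_apply_of_ne_of_ne h3 h4,
    Equiv.swap_apply_of_ne_of_ne h1.symm h3.symm, Equiv.swap_apply_of_ne_of_ne h2.symm h4.symm,
    mul_assoc, this]
  ring

lemma Xop_cybe (q : ι → ℂ) (hq : Function.Injective q) (i j m : ι) (h1 : i ≠ j) (h2 : i ≠ m)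
    (h3 : j ≠ m) :
    (Xop q i m * Xop q j m - Xop q j m * Xop q i m) + (Xop q i m * Xop q j i - Xop q j i * Xop q i m)
      + (Xop q i j * Xop q j m - Xop q j m * Xop q i j) = 0 := by
  have c1 : Equiv.swap i m * Equiv.swap j i = Equiv.swap i j * Equiv.swap j m := by
    ext x
    simp only [Equiv.Perm.mul_apply, Equiv.swap_apply_def]
    split_ifs <;> simp_all
  have c2 : Equiv.swap j m * Equiv.swap i m = Equiv.swap i j * Equiv.swap j m := by
    ext x
    simp only [Equiv.Perm.mul_apply, Equiv.swap_apply_def]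
    split_ifs <;> simp_all
  have c3 : Equiv.swap j i * Equiv.swap i m = Equiv.swap i m * Equiv.swap j m := by
    ext x
    simp only [Equiv.Perm.mul_apply, Equiv.swap_apply_def]
    split_ifs <;> simp_all
  have c4 : Equiv.swap j m * Equiv.swap i j = Equiv.swap i m * Equiv.swap j m := by
    ext x
    simp only [Equiv.Perm.mul_apply, Equiv.swap_apply_def]
    split_ifs <;> simp_all
  apply LinearMap.ext; intro φ; ext σ
  have n1 : q (σ i) - q (σ j) ≠ 0 := sub_ne_zero.2 fun h => h1 (σ.injective (hq h))
  have n2 : q (σ i) - q (σ m) ≠ 0 := sub_ne_zero.2 fun h => h2 (σ.injective (hq h))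
  have n3 : q (σ j) - q (σ m) ≠ 0 := sub_ne_zero.2 fun h => h3 (σ.injective (hq h))
  have n1' : q (σ j) - q (σ i) ≠ 0 := by rw [← neg_sub]; exact neg_ne_zero.2 n1
  have n2' : q (σ m) - q (σ i) ≠ 0 := by rw [← neg_sub]; exact neg_ne_zero.2 n2
  have n3' : q (σ m) - q (σ j) ≠ 0 := by rw [← neg_sub]; exact neg_ne_zero.2 n3
  simp only [LinearMap.add_apply, LinearMap.sub_apply, Module.End.mul_apply, Pi.add_apply,
    Pi.sub_apply, Xop_apply, mul_assoc, c1, c2, c3, c4, LinearMap.zero_apply, Pi.zero_apply,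
    Equiv.Perm.mul_apply, Equiv.swap_apply_left, Equiv.swap_apply_right,
    Equiv.swap_apply_of_ne_of_ne h1 h2, Equiv.swap_apply_of_ne_of_ne h1.symm h3,
    Equiv.swap_apply_of_ne_of_ne h2.symm h3.symm, Equiv.swap_apply_of_ne_of_ne h3.symm h2.symm]
  generalize φ (σ * (Equiv.swap i j * Equiv.swap j m)) = A
  generalize φ (σ * (Equiv.swap i m * Equiv.swap j m)) = B
  generalize q (σ i) = a at *
  generalize q (σ j) = b at *
  generalize q (σ m) = c at *
  field_simp
  ring

lemma end_mul_neg {V : Type} [AddCommGroup V] [Module ℂ V] (A B : Module.End ℂ V) :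
    A * -B = -(A * B) := by
  apply LinearMap.ext; intro x
  simp [Module.End.mul_apply, LinearMap.neg_apply]

lemma end_neg_mul {V : Type} [AddCommGroup V] [Module ℂ V] (A B : Module.End ℂ V) :
    -A * B = -(A * B) := by
  apply LinearMap.ext; intro x
  simp [Module.End.mul_apply, LinearMap.neg_apply]

lemma ring_comm_aux {R : Type} [Ring R] (a b x y : R) :
    (a - x) * (b - y) - (b - y) * (a - x) =
      (a * b - b * a) - (a * y - y * a) + (b * x - x * b) + (x * y - y * x) := by
  noncomm_ring

lemma Yop_comm (q p : ι → ℂ) (hq : Function.Injective q) (i j : ι) :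
    Yop q p i * Yop q p j = Yop q p j * Yop q p i := by
  by_cases hij : i = j
  · rw [hij]
  rw [← sub_eq_zero]
  have hterm : ∀ m n, Xop q i m * Xop q j n - Xop q j n * Xop q i m =
      (if n = m then Xop q i m * Xop q j m - Xop q j m * Xop q i m else 0) +
      (if n = i then Xop q i m * Xop q j i - Xop q j i * Xop q i m else 0) +
      (if m = j then Xop q i j * Xop q j n - Xop q j n * Xop q i j else 0) := by
    intro m n
    by_cases h1 : m = i
    · subst h1
      by_cases h2 : n = m <;> simp [Xop_self, hij]
    by_cases h2 : n = j
    · subst h2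
      by_cases h3 : n = m
      · subst h3; simp [Xop_self, h1]
      · simp [Xop_self, Ne.symm hij, h3]
    by_cases h3 : n = m
    · subst h3; simp [h1, h2]
    by_cases h4 : n = i
    · subst h4
      by_cases h5 : m = j
      · subst h5
        simp [Xop_neg q n m, h3, end_mul_neg, end_neg_mul]
      · simp [h3, h5]
    · by_cases h5 : m = j
      · subst h5; simp [h3, h4]
      · simp only [h3, h4, h5, if_false, add_zero]
        rw [Xop_comm q i m j n hij (Ne.symm h4) h5 (Ne.symm h3), sub_self]
  have hXX : (∑ m, Xop q i m) * (∑ n, Xop q j n) - (∑ n, Xop q j n) * (∑ m, Xop q i m) = 0 := by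
    rw [Finset.sum_mul_sum, Finset.sum_mul_sum, Finset.sum_comm (s := univ) (t := univ)
      (f := fun n m => Xop q j n * Xop q i m), ← Finset.sum_sub_distrib]
    simp only [← Finset.sum_sub_distrib]
    rw [Finset.sum_congr rfl fun m _ => Finset.sum_congr rfl fun n _ => hterm m n]
    simp only [Finset.sum_add_distrib]
    simp only [Finset.sum_ite_eq', Finset.mem_univ, if_true]
    rw [Finset.sum_comm (s := univ) (t := univ)
      (f := fun m n => if m = j then Xop q i j * Xop q j n - Xop q j n * Xop q i j else 0)]
    simp only [Finset.sum_ite_eq', Finset.mem_univ, if_true]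
    rw [← Finset.sum_add_distrib, ← Finset.sum_add_distrib]
    refine Finset.sum_eq_zero fun m _ => ?_
    by_cases h1 : i = m
    · subst h1; simp [Xop_self, Xop_neg q i j, end_mul_neg, end_neg_mul]
    by_cases h2 : j = m
    · subst h2; simp [Xop_self, Xop_neg q i j, end_mul_neg, end_neg_mul]
    exact Xop_cybe q hq i j m hij h1 h2
  have hPX : ∀ i j, i ≠ j → Pop p i * (∑ n, Xop q j n) - (∑ n, Xop q j n) * Pop p i =
      Pop p i * Xop q j i - Xop q j i * Pop p i := by
    intro i j hij
    rw [Finset.mul_sum, Finset.sum_mul, ← Finset.sum_sub_distrib]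
    refine Finset.sum_eq_single i (fun n _ hn => ?_) (by simp)
    rw [Pop_Xop_comm q p i j n hij (Ne.symm hn), sub_self]
  have e1 := hPX i j hij
  have e2 := hPX j i (Ne.symm hij)
  have e3 := Pop_mul_Xop q p i j
  have e4 := Pop_mul_Xop q p j i
  rw [Xop_neg q i j] at e4 e1
  have e5 := Pop_comm p i j
  have : Yop q p i * Yop q p j - Yop q p j * Yop q p i =
      (Pop p i * Pop p j - Pop p j * Pop p i)
      - (Pop p i * (∑ n, Xop q j n) - (∑ n, Xop q j n) * Pop p i)
      + (Pop p j * (∑ n, Xop q i n) - (∑ n, Xop q i n) * Pop p j)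
      + ((∑ m, Xop q i m) * (∑ n, Xop q j n) - (∑ n, Xop q j n) * (∑ m, Xop q i m)) := by
    exact ring_comm_aux _ _ _ _
  rw [this, hXX, e1, e2, e5, sub_self]
  rw [end_mul_neg, end_neg_mul] at e4 ⊢
  rw [e3, neg_injective e4]
  abel

lemma exists_joint {V : Type} [AddCommGroup V] [Module ℂ V] [FiniteDimensional ℂ V]
    (f : ι → Module.End ℂ V) (hf : ∀ i j, f i * f j = f j * f i) (W : Submodule ℂ V) (hW : W ≠ ⊥)
    (hfW : ∀ i, ∀ x ∈ W, f i x ∈ W) :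
    ∃ w ∈ W, w ≠ 0 ∧ ∃ μ : ι → ℂ, ∀ i, f i w = μ i • w := by
  have main : ∀ s : Finset ι, ∃ W' : Submodule ℂ V, W' ≤ W ∧ W' ≠ ⊥ ∧
      (∀ i, ∀ x ∈ W', f i x ∈ W') ∧ ∃ μ : ι → ℂ, ∀ i ∈ s, ∀ x ∈ W', f i x = μ i • x := by
    intro s
    induction s using Finset.induction_on with
    | empty => exact ⟨W, le_rfl, hW, hfW, 0, by simp⟩
    | insert a s ha ih =>
      obtain ⟨W', h1, h2, h3, μ, h4⟩ := ih
      have : Nontrivial W' := Submodule.nontrivial_iff_ne_bot.2 h2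
      obtain ⟨c, hc⟩ := Module.End.exists_eigenvalue ((f a).restrict (h3 a))
      obtain ⟨x, hx⟩ := hc.exists_hasEigenvector
      have hx1 : f a x = c • (x : V) := by
        have := hx.apply_eq_smul
        simpa using congrArg Subtype.val this
      refine ⟨W' ⊓ (f a).eigenspace c, inf_le_left.trans h1, ?_, ?_, Function.update μ a c, ?_⟩
      · intro h
        have : (x : V) ∈ W' ⊓ (f a).eigenspace c :=
          ⟨x.2, Module.End.mem_eigenspace_iff.2 hx1⟩
        rw [h, Submodule.mem_bot] at this
        exact hx.2 (Subtype.ext this)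
      · rintro i y ⟨hy1, hy2⟩
        refine ⟨h3 i y hy1, ?_⟩
        rw [SetLike.mem_coe, Module.End.mem_eigenspace_iff] at hy2 ⊢
        rw [← Module.End.mul_apply, hf, Module.End.mul_apply, hy2, map_smul]
      · rintro i hi y ⟨hy1, hy2⟩
        rw [SetLike.mem_coe, Module.End.mem_eigenspace_iff] at hy2
        rcases Finset.mem_insert.1 hi with h | h
        · subst h; simpa using hy2
        · have : i ≠ a := fun h' => ha (h' ▸ h)
          simpa [Function.update_of_ne this] using h4 i h y hy1
  obtain ⟨W', h1, h2, -, μ, h4⟩ := main univ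
  obtain ⟨x, hx, hx0⟩ := Submodule.exists_mem_ne_zero_of_ne_bot h2
  exact ⟨x, h1 hx, hx0, μ, fun i => h4 i (mem_univ i) x hx⟩

/-- The intertwiner from vectors to functions on the symmetric group. -/
noncomputable def Jop (i : ι) : (ι → ℂ) →ₗ[ℂ] (Equiv.Perm ι → ℂ) where
  toFun x σ := x (σ i)
  map_add' x y := by ext σ; simp
  map_smul' c x := by ext σ; simp

lemma Yop_Jop (q p : ι → ℂ) (i : ι) (x : ι → ℂ) :
    Yop q p i (Jop i x) = Jop i (Zmat q p *ᵥ x) := by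
  ext σ
  have : Jop i (Zmat q p *ᵥ x) σ = (Zmat q p *ᵥ x) (σ i) := rfl
  rw [this, Zmat_mulVec, ← Equiv.sum_comp σ]
  simp [Yop, LinearMap.sum_apply, Finset.sum_apply, Xop_apply, Pop_apply, Jop]

lemma aeval_Yop_Jop (q p : ι → ℂ) (i : ι) (P : ℂ[X]) (x : ι → ℂ) :
    aeval (Yop q p i) P (Jop i x) = Jop i (aeval (Zmat q p) P *ᵥ x) := by
  induction P using Polynomial.induction_on' generalizing x with
  | add a b ha hb => simp [ha, hb, Matrix.add_mulVec]
  | monomial n c =>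
    rw [aeval_monomial, aeval_monomial]
    have : ∀ n x, ((Yop q p i) ^ n) (Jop i x) = Jop i ((Zmat q p ^ n) *ᵥ x) := by
      intro n
      induction n with
      | zero => intro x; simp
      | succ n ih =>
        intro x
        rw [pow_succ, Module.End.mul_apply, Yop_Jop, ih, pow_succ, Matrix.mulVec_mulVec]
    rw [Module.End.mul_apply, this, ← Matrix.mulVec_mulVec]
    simp [Algebra.algebraMap_eq_smul_one, Matrix.smul_mulVec]

lemma exists_eigenfunction (q p : ι → ℂ) (hq : Function.Injective q) :
    ∃ (μ : ι → ℂ) (φ : Equiv.Perm ι → ℂ), φ ≠ 0 ∧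
      (∀ i, (μ i • (1 : Matrix ι ι ℂ) - Zmat q p).det = 0) ∧
      ∀ k σ, p k * φ σ = μ (σ.symm k) * φ σ +
        ∑ l, (q k - q l)⁻¹ * φ (Equiv.swap k l * σ) := by
  have hcomm : ∀ χ : ℂ[X], ∀ i j, Commute (Yop q p i) (aeval (Yop q p j) χ) := by
    intro χ i j
    induction χ using Polynomial.induction_on' with
    | add a b ha hb => rw [map_add]; exact ha.add_right hb
    | monomial n c =>
      rw [aeval_monomial]
      exact (Algebra.commute_algebraMap_right c _).mul_right
        (Commute.pow_right (Yop_comm q p hq i j) n)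
  set χ := (Zmat q p).charpoly with hχ
  set W : Submodule ℂ (Equiv.Perm ι → ℂ) := ⨅ i, LinearMap.ker (aeval (Yop q p i) χ) with hW
  have hone : (1 : Equiv.Perm ι → ℂ) ∈ W := by
    rw [hW, Submodule.mem_iInf]
    intro i
    rw [LinearMap.mem_ker]
    have := aeval_Yop_Jop q p i χ 1
    rw [hχ, Matrix.aeval_self_charpoly, Matrix.zero_mulVec, map_zero] at this
    exact this
  obtain ⟨φ, hφW, hφ0, μ, hφ⟩ := exists_joint (Yop q p) (Yop_comm q p hq) W
    (fun h => by
      rw [h, Submodule.mem_bot] at hone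
      exact one_ne_zero hone)
    (fun i x hx => by
      rw [hW, Submodule.mem_iInf] at hx ⊢
      intro j
      have := hx j
      rw [LinearMap.mem_ker] at this ⊢
      rw [← Module.End.mul_apply, ← (hcomm χ i j).eq, Module.End.mul_apply, this, map_zero])
  refine ⟨μ, φ, hφ0, ?_, ?_⟩
  · intro i
    rw [hW, Submodule.mem_iInf] at hφW
    have h1 := hφW i
    rw [LinearMap.mem_ker, Module.End.aeval_apply_of_hasEigenvector
      (μ := μ i) ⟨Module.End.mem_eigenspace_iff.2 (hφ i), hφ0⟩] at h1
    have h2 := (smul_eq_zero.1 h1).resolve_right hφ0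
    rw [hχ, Matrix.eval_charpoly] at h2
    rw [← h2]
    congr 1
    rw [Matrix.smul_one_eq_diagonal]; rfl
  · intro k σ
    have h := congrFun (hφ (σ.symm k)) σ
    simp only [Yop, LinearMap.sub_apply, LinearMap.sum_apply, Finset.sum_apply, Pi.sub_apply,
      Xop_apply, Pop_apply, Equiv.apply_symm_apply, Pi.smul_apply, smul_eq_mul] at h
    rw [← h, ← Equiv.sum_comp σ (fun l => (q k - q l)⁻¹ * φ (Equiv.swap k l * σ))]
    have : ∀ m, Equiv.swap k (σ m) * σ = σ * Equiv.swap (σ.symm k) m := by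
      intro m
      rw [Equiv.mul_swap_eq_swap_mul, Equiv.apply_symm_apply]
    simp only [this]
    ring


/-- The spectral property of a Calogero-Moser quadruple. -/
def HasP (Q Z : Matrix ι ι ℂ) (v w : ι → ℂ) : Prop :=
  ∃ (q μ : ι → ℂ) (φ : Equiv.Perm ι → ℂ), ‖φ‖ = 1 ∧
    (∀ i, (q i • (1 : Matrix ι ι ℂ) - Q).det = 0) ∧
    (∀ i, (μ i • (1 : Matrix ι ι ℂ) - Z).det = 0) ∧
    ∀ u z : ℂ, (u • (1 : Matrix ι ι ℂ) - Q).det ≠ 0 → (z • (1 : Matrix ι ι ℂ) - Z).det ≠ 0 →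
      ∀ σ, Bop q μ u z φ σ =
        (((-1) ^ Fintype.card ι * ∏ i, (z - μ i)) * ∏ j, (u - q j)) *
          (1 - w ⬝ᵥ ((u • (1 : Matrix ι ι ℂ) - Q)⁻¹ * (z • (1 : Matrix ι ι ℂ) - Z)⁻¹) *ᵥ v) * φ σ

lemma conj_sub (C C' Q : Matrix ι ι ℂ) (h : C * C' = 1) (u : ℂ) :
    u • (1 : Matrix ι ι ℂ) - C * Q * C' = C * (u • (1 : Matrix ι ι ℂ) - Q) * C' := by
  rw [Matrix.mul_sub, Matrix.sub_mul]
  simp [h]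

lemma conj_det (C C' Q : Matrix ι ι ℂ) (h : C * C' = 1) : (C * Q * C').det = Q.det := by
  rw [Matrix.det_mul, Matrix.det_mul, mul_right_comm, ← Matrix.det_mul, h, Matrix.det_one, one_mul]

lemma conj_inv (C C' A : Matrix ι ι ℂ) (h : C * C' = 1) (h' : C' * C = 1) (hA : A.det ≠ 0) :
    (C * A * C')⁻¹ = C * A⁻¹ * C' := by
  apply Matrix.inv_eq_right_inv
  calc C * A * C' * (C * A⁻¹ * C') = C * A * (C' * C) * A⁻¹ * C' := by
        simp only [Matrix.mul_assoc]
    _ = 1 := by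
        rw [h', Matrix.mul_one, Matrix.mul_assoc C A,
          Matrix.mul_nonsing_inv A (isUnit_iff_ne_zero.2 hA), Matrix.mul_one, h]

lemma HasP.conj {Q Z : Matrix ι ι ℂ} {v w : ι → ℂ} (hP : HasP Q Z v w)
    (C C' : Matrix ι ι ℂ) (h : C * C' = 1) (h' : C' * C = 1) :
    HasP (C * Q * C') (C * Z * C') (C *ᵥ v) (w ᵥ* C') := by
  obtain ⟨q, μ, φ, h1, h2, h3, h4⟩ := hP
  refine ⟨q, μ, φ, h1, fun i => ?_, fun i => ?_, fun u z hu hz σ => ?_⟩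
  · rw [conj_sub C C' Q h, conj_det C C' _ h, h2]
  · rw [conj_sub C C' Z h, conj_det C C' _ h, h3]
  · rw [conj_sub C C' _ h, conj_det C C' _ h] at hu hz
    rw [h4 u z hu hz σ, conj_sub C C' _ h, conj_sub C C' _ h, conj_inv C C' _ h h' hu,
      conj_inv C C' _ h h' hz]
    congr 3
    rw [← Matrix.dotProduct_mulVec, Matrix.mulVec_mulVec, Matrix.mulVec_mulVec]
    congr 2
    generalize (u • (1 : Matrix ι ι ℂ) - Q)⁻¹ = A
    generalize (z • (1 : Matrix ι ι ℂ) - Z)⁻¹ = B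
    calc A * B = (C' * C) * A * (C' * C) * B * (C' * C) := by simp [h']
      _ = _ := by simp only [Matrix.mul_assoc]

lemma Bop_smul (q μ : ι → ℂ) (u z c : ℂ) (φ : Equiv.Perm ι → ℂ) (σ) :
    Bop q μ u z (c • φ) σ = c * Bop q μ u z φ σ := by
  unfold Bop
  rw [Finset.mul_sum]
  refine Finset.sum_congr rfl fun τ _ => ?_
  rw [Pi.smul_apply, smul_eq_mul]
  ring

lemma HasP_base (q p : ι → ℂ) (hq : Function.Injective q) :
    HasP (diagonal q) (Zmat q p) 1 1 := by
  obtain ⟨μ, φ, h0, h1, h2⟩ := exists_eigenfunction q p hq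
  refine ⟨q, μ, ((‖φ‖⁻¹ : ℝ) : ℂ) • φ, ?_, fun i => ?_, h1, fun u z hu hz σ => ?_⟩
  · rw [norm_smul]
    have : ‖φ‖ ≠ 0 := norm_ne_zero_iff.2 h0
    simp [this]
  · rw [Matrix.smul_one_eq_diagonal, Matrix.diagonal_sub, Matrix.det_diagonal]
    exact Finset.prod_eq_zero (mem_univ i) (sub_self _)
  · rw [Bop_smul, Bop_eigen q μ p hq φ h2 u z hz _ σ]
    · rw [Pi.smul_apply, smul_eq_mul]; ring
    · intro k hk
      rw [Matrix.smul_one_eq_diagonal, Matrix.diagonal_sub, Matrix.det_diagonal] at hu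
      exact hu (Finset.prod_eq_zero (mem_univ k) (by rw [hk, sub_self]))

/-- Calogero-Moser quadruples. -/
def IsCM (Q Z : Matrix ι ι ℂ) (v w : ι → ℂ) : Prop := Q * Z - Z * Q = 1 - vecMulVec v w

/-- Matrices with simple spectrum. -/
def Simple (Q : Matrix ι ι ℂ) : Prop :=
  ∃ (q : ι → ℂ) (C C' : Matrix ι ι ℂ), Function.Injective q ∧ C * C' = 1 ∧ C' * C = 1 ∧
    Q = C * diagonal q * C'

lemma IsCM.conj {κ : Type} [Fintype κ] [DecidableEq κ]
    {Q Z : Matrix ι ι ℂ} {v w : ι → ℂ} (hP : IsCM Q Z v w)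
    (C : Matrix κ ι ℂ) (C' : Matrix ι κ ℂ) (h : C * C' = 1) (h' : C' * C = 1) :
    IsCM (C * Q * C') (C * Z * C') (C *ᵥ v) (w ᵥ* C') := by
  unfold IsCM at *
  have e : vecMulVec (C *ᵥ v) (w ᵥ* C') = C * vecMulVec v w * C' := by
    rw [Matrix.mul_vecMulVec, Matrix.vecMulVec_mul]
  have a : ∀ A B : Matrix ι ι ℂ, C * A * C' * (C * B * C') = C * (A * B) * C' := by
    intro A B
    calc C * A * C' * (C * B * C') = C * A * (C' * C) * B * C' := by simp only [Matrix.mul_assoc]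
      _ = _ := by rw [h', Matrix.mul_one]; simp only [Matrix.mul_assoc]
  rw [a, a, ← Matrix.sub_mul, ← Matrix.mul_sub, hP, e, Matrix.mul_sub, Matrix.sub_mul,
    Matrix.mul_one, h]

lemma HasP_of_simple {Q Z : Matrix ι ι ℂ} {v w : ι → ℂ} (hcm : IsCM Q Z v w) (hs : Simple Q) :
    HasP Q Z v w := by
  obtain ⟨q, C, C', hq, h, h', rfl⟩ := hs
  have h1 := hcm.conj C' C h' h
  have e1 : C' * (C * diagonal q * C') * C = diagonal q := by
    calc C' * (C * diagonal q * C') * C = (C' * C) * diagonal q * (C' * C) := by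
          simp only [Matrix.mul_assoc]
      _ = _ := by simp [h']
  rw [e1] at h1
  set Z1 := C' * Z * C with hZ1
  set v1 := C' *ᵥ v with hv1
  set w1 := w ᵥ* C with hw1
  have ent : ∀ k l, (q k - q l) * Z1 k l = (1 : Matrix ι ι ℂ) k l - v1 k * w1 l := by
    intro k l
    have := congrFun (congrFun h1 k) l
    rw [Matrix.sub_apply, Matrix.sub_apply, Matrix.diagonal_mul, Matrix.mul_diagonal,
      Matrix.vecMulVec_apply] at this
    rw [← this]; ring
  have hvw : ∀ k, v1 k * w1 k = 1 := by
    intro k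
    have := ent k k
    rw [sub_self, zero_mul, Matrix.one_apply_eq] at this
    linear_combination this
  have hwv : ∀ k, w1 k * v1 k = 1 := fun k => by rw [mul_comm, hvw]
  set p : ι → ℂ := fun k => Z1 k k
  have hZ : Z1 = diagonal v1 * Zmat q p * diagonal w1 := by
    ext k l
    rw [Matrix.mul_diagonal, Matrix.diagonal_mul, Zmat, Matrix.sub_apply, Matrix.of_apply]
    by_cases hkl : k = l
    · subst hkl
      rw [sub_self, _root_.inv_zero, sub_zero, Matrix.diagonal_apply_eq]
      linear_combination (-Z1 k k) * hvw k
    · rw [Matrix.diagonal_apply_ne _ hkl]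
      have hne : q k - q l ≠ 0 := sub_ne_zero.2 fun hh => hkl (hq hh)
      have := ent k l
      rw [Matrix.one_apply_ne hkl] at this
      field_simp
      linear_combination this
  have d1 : diagonal v1 * diagonal w1 = (1 : Matrix ι ι ℂ) := by
    rw [Matrix.diagonal_mul_diagonal, ← Matrix.diagonal_one]; congr 1; ext k; exact hvw k
  have d2 : diagonal w1 * diagonal v1 = (1 : Matrix ι ι ℂ) := by
    rw [Matrix.diagonal_mul_diagonal, ← Matrix.diagonal_one]; congr 1; ext k; exact hwv k
  have key := ((HasP_base q p hq).conj (diagonal v1) (diagonal w1) d1 d2).conj C C' h h'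
  have f1 : diagonal v1 * diagonal q * diagonal w1 = diagonal q := by
    rw [Matrix.diagonal_mul_diagonal, Matrix.diagonal_mul_diagonal]; congr 1; ext k
    linear_combination q k * hvw k
  have f2 : diagonal v1 *ᵥ (1 : ι → ℂ) = v1 := by ext k; simp [Matrix.mulVec_diagonal]
  have f3 : (1 : ι → ℂ) ᵥ* diagonal w1 = w1 := by ext k; simp [Matrix.vecMul_diagonal]
  rw [f1, f2, f3, ← hZ, hZ1, hv1, hw1, Matrix.mulVec_mulVec, Matrix.vecMul_vecMul, h,
    Matrix.one_mulVec, Matrix.vecMul_one] at key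
  have f4 : C * (C' * Z * C) * C' = Z := by
    calc C * (C' * Z * C) * C' = (C * C') * Z * (C * C') := by
          simp only [Matrix.mul_assoc]
      _ = _ := by simp [h]
  rwa [f4] at key


open Filter Topology in
lemma tendsto_matrix_inv {α : Type*} {l : Filter α} {f : α → Matrix ι ι ℂ} {A : Matrix ι ι ℂ}
    (hf : Tendsto f l (𝓝 A)) (hA : A.det ≠ 0) : Tendsto (fun a => (f a)⁻¹) l (𝓝 A⁻¹) := by
  simp only [Matrix.inv_def, Ring.inverse_eq_inv']
  have h1 : Tendsto (fun a => (f a).det) l (𝓝 A.det) :=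
    ((continuous_id.matrix_det).tendsto A).comp hf
  have h2 : Tendsto (fun a => (f a).adjugate) l (𝓝 A.adjugate) :=
    ((continuous_id.matrix_adjugate).tendsto A).comp hf
  exact (h1.inv₀ hA).smul h2

open Filter Topology in
lemma tendsto_form {α : Type*} {l : Filter α} {f g : α → Matrix ι ι ℂ} {v w : α → ι → ℂ}
    {A B : Matrix ι ι ℂ} {v' w' : ι → ℂ} (hf : Tendsto f l (𝓝 A)) (hg : Tendsto g l (𝓝 B))
    (hv : Tendsto v l (𝓝 v')) (hw : Tendsto w l (𝓝 w')) :
    Tendsto (fun a => w a ⬝ᵥ (f a * g a) *ᵥ v a) l (𝓝 (w' ⬝ᵥ (A * B) *ᵥ v')) := by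
  have hf' : ∀ i j, Tendsto (fun a => f a i j) l (𝓝 (A i j)) := fun i j =>
    tendsto_pi_nhds.1 (tendsto_pi_nhds.1 hf i) j
  have hg' : ∀ i j, Tendsto (fun a => g a i j) l (𝓝 (B i j)) := fun i j =>
    tendsto_pi_nhds.1 (tendsto_pi_nhds.1 hg i) j
  simp only [dotProduct, mulVec, Matrix.mul_apply]
  exact tendsto_finsetSum _ fun i _ => (tendsto_pi_nhds.1 hw i).mul
    (tendsto_finsetSum _ fun j _ => (tendsto_finsetSum _ fun k _ =>
      (hf' i k).mul (hg' k j)).mul (tendsto_pi_nhds.1 hv j))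

lemma eig_bound (Q : Matrix ι ι ℂ) (c : ℂ) (h : (c • (1 : Matrix ι ι ℂ) - Q).det = 0) :
    ‖c‖ ≤ ∑ k, ∑ l, ‖Q k l‖ := by
  obtain ⟨x, hx0, hx⟩ := Matrix.exists_mulVec_eq_zero_iff.2 h
  rw [Matrix.sub_mulVec, Matrix.smul_mulVec, Matrix.one_mulVec, sub_eq_zero] at hx
  have hpos : 0 < ‖x‖ := norm_pos_iff.2 hx0
  have : ‖c‖ * ‖x‖ ≤ (∑ k, ∑ l, ‖Q k l‖) * ‖x‖ := by
    rw [← norm_smul, hx]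
    refine (pi_norm_le_iff_of_nonneg (by positivity)).2 fun k => ?_
    calc ‖(Q *ᵥ x) k‖ ≤ ∑ l, ‖Q k l * x l‖ := norm_sum_le _ _
      _ ≤ ∑ l, ‖Q k l‖ * ‖x‖ := Finset.sum_le_sum fun l _ => by
          rw [norm_mul]; exact mul_le_mul_of_nonneg_left (norm_le_pi_norm x l) (norm_nonneg _)
      _ = (∑ l, ‖Q k l‖) * ‖x‖ := by rw [Finset.sum_mul]
      _ ≤ _ := by
          refine mul_le_mul_of_nonneg_right ?_ hpos.le
          exact Finset.single_le_sum (f := fun k => ∑ l, ‖Q k l‖)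
            (fun k _ => by positivity) (mem_univ k)
  exact le_of_mul_le_mul_right this hpos

/-- Quadruples. -/
abbrev Quad (ι : Type) := Matrix ι ι ℂ × Matrix ι ι ℂ × (ι → ℂ) × (ι → ℂ)

open Filter Topology in
lemma HasP_limit (x : ℕ → Quad ι) (y : Quad ι) (hx : Tendsto x atTop (𝓝 y))
    (hP : ∀ n, HasP (x n).1 (x n).2.1 (x n).2.2.1 (x n).2.2.2) :
    HasP y.1 y.2.1 y.2.2.1 y.2.2.2 := by
  choose q μ φ h1 h2 h3 h4 using hP
  have hQ : Tendsto (fun n => (x n).1) atTop (𝓝 y.1) := (continuous_fst.tendsto y).comp hx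
  have hZ : Tendsto (fun n => (x n).2.1) atTop (𝓝 y.2.1) :=
    ((continuous_fst.comp continuous_snd).tendsto y).comp hx
  have hv : Tendsto (fun n => (x n).2.2.1) atTop (𝓝 y.2.2.1) :=
    ((continuous_fst.comp (continuous_snd.comp continuous_snd)).tendsto y).comp hx
  have hw : Tendsto (fun n => (x n).2.2.2) atTop (𝓝 y.2.2.2) :=
    ((continuous_snd.comp (continuous_snd.comp continuous_snd)).tendsto y).comp hx
  have hS : Continuous fun Q : Matrix ι ι ℂ => ∑ k, ∑ l, ‖Q k l‖ := by fun_prop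
  obtain ⟨b1, hb1⟩ := ((hS.tendsto _).comp hQ).bddAbove_range
  obtain ⟨b2, hb2⟩ := ((hS.tendsto _).comp hZ).bddAbove_range
  have hb1' : ∀ n i, ‖q n i‖ ≤ b1 := fun n i =>
    (eig_bound _ _ (h2 n i)).trans (hb1 ⟨n, rfl⟩)
  have hb2' : ∀ n i, ‖μ n i‖ ≤ b2 := fun n i =>
    (eig_bound _ _ (h3 n i)).trans (hb2 ⟨n, rfl⟩)
  set R := max (max b1 b2) 1 with hR
  have hR0 : 0 ≤ R := le_trans zero_le_one (le_max_right _ _)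
  have hmem : ∀ n, (q n, μ n, φ n) ∈
      Metric.closedBall (0 : (ι → ℂ) × (ι → ℂ) × (Equiv.Perm ι → ℂ)) R := by
    intro n
    rw [mem_closedBall_zero_iff, norm_prod_le_iff, norm_prod_le_iff]
    refine ⟨(pi_norm_le_iff_of_nonneg hR0).2 fun i => (hb1' n i).trans ?_,
      (pi_norm_le_iff_of_nonneg hR0).2 fun i => (hb2' n i).trans ?_, ?_⟩
    · exact (le_max_left _ _).trans (le_max_left _ _)
    · exact (le_max_right _ _).trans (le_max_left _ _)
    · simp only [h1]; exact le_max_right _ _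
  obtain ⟨⟨q', μ', φ'⟩, -, s, hs, hlim⟩ :=
    tendsto_subseq_of_bounded Metric.isBounded_closedBall hmem
  have lq : Tendsto (fun n => q (s n)) atTop (𝓝 q') := (continuous_fst.tendsto _).comp hlim
  have lμ : Tendsto (fun n => μ (s n)) atTop (𝓝 μ') :=
    ((continuous_fst.comp continuous_snd).tendsto _).comp hlim
  have lφ : Tendsto (fun n => φ (s n)) atTop (𝓝 φ') :=
    ((continuous_snd.comp continuous_snd).tendsto _).comp hlim
  have lQ := hQ.comp hs.tendsto_atTop
  have lZ := hZ.comp hs.tendsto_atTop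
  have lv := hv.comp hs.tendsto_atTop
  have lw := hw.comp hs.tendsto_atTop
  have lqi : ∀ i, Tendsto (fun n => q (s n) i) atTop (𝓝 (q' i)) := tendsto_pi_nhds.1 lq
  have lμi : ∀ i, Tendsto (fun n => μ (s n) i) atTop (𝓝 (μ' i)) := tendsto_pi_nhds.1 lμ
  have lφi : ∀ i, Tendsto (fun n => φ (s n) i) atTop (𝓝 (φ' i)) := tendsto_pi_nhds.1 lφ
  have hdet : ∀ (f : ℕ → Matrix ι ι ℂ) (A : Matrix ι ι ℂ), Tendsto f atTop (𝓝 A) →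
      Tendsto (fun n => (f n).det) atTop (𝓝 A.det) := fun f A hf =>
    ((continuous_id.matrix_det).tendsto A).comp hf
  refine ⟨q', μ', φ', ?_, fun i => ?_, fun i => ?_, fun u z hu hz σ => ?_⟩
  · refine tendsto_nhds_unique lφ.norm ?_
    simp only [h1]; exact tendsto_const_nhds
  · refine tendsto_nhds_unique (hdet _ _ (((lqi i).smul_const 1).sub lQ)) ?_
    simp only [Function.comp, h2]; exact tendsto_const_nhds
  · refine tendsto_nhds_unique (hdet _ _ (((lμi i).smul_const 1).sub lZ)) ?_
    simp only [Function.comp, h3]; exact tendsto_const_nhds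
  · have lu := (tendsto_const_nhds (x := u • (1 : Matrix ι ι ℂ))).sub lQ
    have lz := (tendsto_const_nhds (x := z • (1 : Matrix ι ι ℂ))).sub lZ
    have eu := (hdet _ _ lu).eventually_ne hu
    have ez := (hdet _ _ lz).eventually_ne hz
    have lB : Tendsto (fun n => Bop (q (s n)) (μ (s n)) u z (φ (s n)) σ) atTop
        (𝓝 (Bop q' μ' u z φ' σ)) := by
      unfold Bop
      refine tendsto_finsetSum _ fun τ _ => ((tendsto_const_nhds.mul (lφi _))).mul ?_
      refine tendsto_finsetProd _ fun k _ => ?_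
      split_ifs
      · exact tendsto_const_nhds.sub ((tendsto_const_nhds.sub (lqi _)).mul
          (tendsto_const_nhds.sub (lμi _)))
      · exact tendsto_const_nhds
    refine tendsto_nhds_unique_of_eventuallyEq lB ?_ ?_ (b := _) (g := fun n =>
      (((-1) ^ Fintype.card ι * ∏ i, (z - μ (s n) i)) * ∏ j, (u - q (s n) j)) *
          (1 - (x (s n)).2.2.2 ⬝ᵥ ((u • (1 : Matrix ι ι ℂ) - (x (s n)).1)⁻¹ *
            (z • (1 : Matrix ι ι ℂ) - (x (s n)).2.1)⁻¹) *ᵥ (x (s n)).2.2.1) * φ (s n) σ)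
    · refine Tendsto.mul (Tendsto.mul (Tendsto.mul (tendsto_const_nhds.mul ?_) ?_) ?_) (lφi σ)
      · exact tendsto_finsetProd _ fun k _ => tendsto_const_nhds.sub (lμi _)
      · exact tendsto_finsetProd _ fun k _ => tendsto_const_nhds.sub (lqi _)
      · refine tendsto_const_nhds.sub ?_
        have l1 := (tendsto_matrix_inv lu hu)
        have l2 := (tendsto_matrix_inv lz hz)
        exact tendsto_form l1 l2 lv lw
    · filter_upwards [eu, ez] with n hu hz
      exact h4 (s n) u z hu hz σ

/-- The set of simple Calogero-Moser quadruples. -/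
def SimpleCM (ι : Type) [Fintype ι] [DecidableEq ι] : Set (Quad ι) :=
  {x | IsCM x.1 x.2.1 x.2.2.1 x.2.2.2 ∧ Simple x.1}

lemma HasP_of_closure (y : Quad ι) (hy : y ∈ closure (SimpleCM ι)) :
    HasP y.1 y.2.1 y.2.2.1 y.2.2.2 := by
  have : FirstCountableTopology (Matrix ι ι ℂ) :=
    inferInstanceAs (FirstCountableTopology (ι → ι → ℂ))
  obtain ⟨x, hx, hlim⟩ := mem_closure_iff_seq_limit.1 hy
  exact HasP_limit x y hlim fun n => HasP_of_simple (hx n).1 (hx n).2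


section blocks
variable {α β : Type} [Fintype α] [DecidableEq α] [Fintype β] [DecidableEq β]

lemma simple_rect (e : α ≃ ι) (q : α → ℂ) (hq : Function.Injective q)
    (C : Matrix ι α ℂ) (C' : Matrix α ι ℂ) (h : C * C' = 1) (h' : C' * C = 1) :
    Simple (C * diagonal q * C') := by
  refine ⟨q ∘ e.symm, C.submatrix id e.symm, C'.submatrix e.symm id,
    hq.comp e.symm.injective, ?_, ?_, ?_⟩
  · rw [Matrix.submatrix_mul_equiv, h]; rfl
  · have := Matrix.submatrix_mul_equiv C' C e.symm (Equiv.refl ι) e.symm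
    rw [h', Matrix.submatrix_one_equiv] at this
    exact this
  · have : diagonal (q ∘ e.symm) = (diagonal q).submatrix e.symm e.symm := by
      rw [Matrix.submatrix_diagonal_equiv]
    rw [this, Matrix.submatrix_mul_equiv, Matrix.submatrix_mul_equiv]; rfl

lemma simple_conj (e : α ≃ ι) {Q : Matrix α α ℂ} (hQ : Simple Q)
    (C : Matrix ι α ℂ) (C' : Matrix α ι ℂ) (h : C * C' = 1) (h' : C' * C = 1) :
    Simple (C * Q * C') := by
  obtain ⟨q, D, D', hq, h1, h2, rfl⟩ := hQ
  have : C * (D * diagonal q * D') * C' = (C * D) * diagonal q * (D' * C') := by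
    simp only [Matrix.mul_assoc]
  rw [this]
  refine simple_rect e q hq _ _ ?_ ?_
  · calc C * D * (D' * C') = C * (D * D') * C' := by simp only [Matrix.mul_assoc]
      _ = 1 := by rw [h1, Matrix.mul_one, h]
  · calc D' * C' * (C * D) = D' * (C' * C) * D := by simp only [Matrix.mul_assoc]
      _ = 1 := by rw [h', Matrix.mul_one, h2]

lemma closure_conj (e : α ≃ ι) (x : Quad α) (hx : x ∈ closure (SimpleCM α))
    (C : Matrix ι α ℂ) (C' : Matrix α ι ℂ) (h : C * C' = 1) (h' : C' * C = 1) :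
    ((C * x.1 * C', C * x.2.1 * C', C *ᵥ x.2.2.1, x.2.2.2 ᵥ* C') : Quad ι) ∈
      closure (SimpleCM ι) := by
  refine map_mem_closure (f := fun x : Quad α =>
    ((C * x.1 * C', C * x.2.1 * C', C *ᵥ x.2.2.1, x.2.2.2 ᵥ* C') : Quad ι)) ?_ hx ?_
  · refine Continuous.prodMk ?_ (Continuous.prodMk ?_ (Continuous.prodMk ?_ ?_))
    · exact (continuous_const.matrix_mul continuous_fst).matrix_mul continuous_const
    · exact (continuous_const.matrix_mul (continuous_fst.comp continuous_snd)).matrix_mul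
        continuous_const
    · exact continuous_const.matrix_mulVec
        (continuous_fst.comp (continuous_snd.comp continuous_snd))
    · exact (continuous_snd.comp (continuous_snd.comp continuous_snd)).matrix_vecMul
        continuous_const
  · rintro y ⟨h1, h2⟩
    exact ⟨h1.conj C C' h h', simple_conj e h2 C C' h h'⟩

/-- The Sylvester operator as a matrix. -/
noncomputable def syl (A : Matrix α α ℂ) (B : Matrix β β ℂ) : Matrix (α × β) (α × β) ℂ :=
  Matrix.kroneckerMap (· * ·) A (1 : Matrix β β ℂ) - Matrix.kroneckerMap (· * ·) (1 : Matrix α α ℂ) Bᵀ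

lemma syl_mulVec (A : Matrix α α ℂ) (B : Matrix β β ℂ) (x : α × β → ℂ) (i : α) (j : β) :
    (syl A B *ᵥ x) (i, j) = (A * Matrix.of (fun a b => x (a, b)) -
      Matrix.of (fun a b => x (a, b)) * B) i j := by
  rw [syl, Matrix.sub_mulVec]
  simp [Matrix.mulVec, dotProduct, Matrix.mul_apply,
    Fintype.sum_prod_type, Matrix.one_apply, mul_comm]

/-- Solution of the Sylvester equation. -/
noncomputable def sol (A : Matrix α α ℂ) (B : Matrix β β ℂ) (R : Matrix α β ℂ) : Matrix α β ℂ :=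
  Matrix.of fun i j => ((syl A B)⁻¹ *ᵥ (fun ij => R ij.1 ij.2)) (i, j)

lemma sol_spec (A : Matrix α α ℂ) (B : Matrix β β ℂ) (R : Matrix α β ℂ) (h : (syl A B).det ≠ 0) :
    A * sol A B R - sol A B R * B = R := by
  ext i j
  have := syl_mulVec A B ((syl A B)⁻¹ *ᵥ (fun ij => R ij.1 ij.2)) i j
  rw [Matrix.mulVec_mulVec, Matrix.mul_nonsing_inv _ (isUnit_iff_ne_zero.2 h),
    Matrix.one_mulVec] at this
  exact this.symm

lemma syl_inj (A : Matrix α α ℂ) (B : Matrix β β ℂ) (h : (syl A B).det ≠ 0) (X : Matrix α β ℂ)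
    (hX : A * X = X * B) : X = 0 := by
  by_contra hne
  apply h
  refine Matrix.exists_mulVec_eq_zero_iff.1 ⟨fun ij => X ij.1 ij.2, ?_, ?_⟩
  · intro h0
    apply hne
    ext i j
    exact congrFun h0 (i, j)
  · ext ⟨i, j⟩
    rw [syl_mulVec]
    have : (Matrix.of fun a b => X a b) = X := rfl
    rw [this, hX, sub_self]; rfl

lemma syl_det_ne (A : Matrix α α ℂ) (B : Matrix β β ℂ) (h : ∀ X : Matrix α β ℂ, A * X = X * B → X = 0) :
    (syl A B).det ≠ 0 := by
  intro h0
  obtain ⟨x, hx0, hx⟩ := Matrix.exists_mulVec_eq_zero_iff.2 h0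
  apply hx0
  have := h (Matrix.of (fun a b => x (a, b))) (by
    rw [← sub_eq_zero]
    ext i j
    rw [← syl_mulVec, hx]; rfl)
  ext ⟨i, j⟩
  exact congrFun (congrFun this i) j

/-- Gluing of two quadruples. -/
noncomputable def glue (d : Quad α × Quad β) : Quad (α ⊕ β) :=
  (fromBlocks d.1.1 0 0 d.2.1,
   fromBlocks d.1.2.1 (sol d.1.1 d.2.1 (-vecMulVec d.1.2.2.1 d.2.2.2.2))
    (sol d.2.1 d.1.1 (-vecMulVec d.2.2.2.1 d.1.2.2.2)) d.2.2.1,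
   Sum.elim d.1.2.2.1 d.2.2.2.1, Sum.elim d.1.2.2.2 d.2.2.2.2)

lemma vecMulVec_sum_elim (v : α → ℂ) (v' : β → ℂ) (w : α → ℂ) (w' : β → ℂ) :
    vecMulVec (Sum.elim v v') (Sum.elim w w') =
      fromBlocks (vecMulVec v w) (vecMulVec v w') (vecMulVec v' w) (vecMulVec v' w') := by
  ext (i | i) (j | j) <;> rfl

lemma isCM_blocks (Q1 Z11 : Matrix α α ℂ) (Z12 : Matrix α β ℂ) (Z21 : Matrix β α ℂ)
    (Q2 Z22 : Matrix β β ℂ) (v1 w1 : α → ℂ) (v2 w2 : β → ℂ) :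
    IsCM (fromBlocks Q1 0 0 Q2) (fromBlocks Z11 Z12 Z21 Z22) (Sum.elim v1 v2) (Sum.elim w1 w2) ↔
    IsCM Q1 Z11 v1 w1 ∧ Q1 * Z12 - Z12 * Q2 = -vecMulVec v1 w2 ∧
      Q2 * Z21 - Z21 * Q1 = -vecMulVec v2 w1 ∧ IsCM Q2 Z22 v2 w2 := by
  unfold IsCM
  rw [vecMulVec_sum_elim, Matrix.fromBlocks_multiply, Matrix.fromBlocks_multiply,
    ← Matrix.fromBlocks_one, sub_eq_add_neg, sub_eq_add_neg (fromBlocks 1 0 0 1),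
    Matrix.fromBlocks_neg, Matrix.fromBlocks_neg,
    Matrix.fromBlocks_add, Matrix.fromBlocks_add, Matrix.fromBlocks_inj]
  simp [sub_eq_add_neg]

lemma glue_mem (d : Quad α × Quad β) (h1 : d.1 ∈ SimpleCM α) (h2 : d.2 ∈ SimpleCM β)
    (hd : (syl d.1.1 d.2.1).det ≠ 0) (hd' : (syl d.2.1 d.1.1).det ≠ 0) :
    glue d ∈ SimpleCM (α ⊕ β) := by
  refine ⟨(isCM_blocks _ _ _ _ _ _ _ _ _ _).2 ⟨h1.1, sol_spec _ _ _ hd, sol_spec _ _ _ hd', h2.1⟩,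
    ?_⟩
  obtain ⟨q, C, C', hq, a1, a2, a3⟩ := h1.2
  obtain ⟨r, D, D', hr, b1, b2, b3⟩ := h2.2
  refine ⟨Sum.elim q r, fromBlocks C 0 0 D, fromBlocks C' 0 0 D', ?_, ?_, ?_, ?_⟩
  · refine Function.Injective.sumElim hq hr fun i j hij => ?_
    obtain ⟨E, hE⟩ : ∃ E : Matrix α β ℂ, E = Matrix.single i j 1 := ⟨_, rfl⟩
    have := syl_inj _ _ hd (C * E * D') (by
      rw [a3, b3]
      calc C * diagonal q * C' * (C * E * D')
          = C * (diagonal q * (C' * C) * E) * D' := by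
            simp only [Matrix.mul_assoc]
        _ = C * (E * (D' * D) * diagonal r) * D' := by
            rw [a2, b2, Matrix.mul_one, Matrix.mul_one]
            congr 2
            rw [hE]
            ext k l
            rw [Matrix.diagonal_mul, Matrix.mul_diagonal, Matrix.single_apply]
            split_ifs with hh
            · rw [← hh.1, ← hh.2, hij]; ring
            · simp
        _ = _ := by simp only [Matrix.mul_assoc])
    have h0 : E = 0 := by
      calc E = (C' * C) * E * (D' * D) := by
            rw [a2, b2, Matrix.mul_one, Matrix.one_mul]
        _ = C' * (C * E * D') * D := by simp only [Matrix.mul_assoc]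
        _ = 0 := by rw [this]; simp
    rw [hE] at h0
    have := congrFun (congrFun h0 i) j
    simp at this
  · rw [Matrix.fromBlocks_multiply, ← Matrix.fromBlocks_one]; simp [a1, b1]
  · rw [Matrix.fromBlocks_multiply, ← Matrix.fromBlocks_one]; simp [a2, b2]
  · rw [← Matrix.fromBlocks_diagonal, Matrix.fromBlocks_multiply, Matrix.fromBlocks_multiply]
    simp [glue, a3, b3]

open Filter Topology in
lemma continuous_syl {γ : Type*} [TopologicalSpace γ] (f : γ → Matrix α α ℂ) (g : γ → Matrix β β ℂ)
    (hf : Continuous f) (hg : Continuous g) :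
    Continuous fun x => syl (f x) (g x) := by
  unfold syl
  refine Continuous.sub ?_ ?_
  · refine continuous_matrix fun i j => ?_
    simp only [Matrix.kroneckerMap_apply]
    exact (hf.matrix_elem _ _).mul continuous_const
  · refine continuous_matrix fun i j => ?_
    simp only [Matrix.kroneckerMap_apply, Matrix.transpose_apply]
    exact continuous_const.mul (hg.matrix_elem _ _)

open Filter Topology in
lemma continuousAt_sol {γ : Type*} [TopologicalSpace γ] (f : γ → Matrix α α ℂ)
    (g : γ → Matrix β β ℂ) (R : γ → Matrix α β ℂ)
    (hf : Continuous f) (hg : Continuous g) (hR : Continuous R) (x : γ)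
    (h : (syl (f x) (g x)).det ≠ 0) :
    ContinuousAt (fun x => sol (f x) (g x) (R x)) x := by
  have h1 : Tendsto (fun y => (syl (f y) (g y))⁻¹) (𝓝 x) (𝓝 (syl (f x) (g x))⁻¹) :=
    tendsto_matrix_inv ((continuous_syl f g hf hg).tendsto x) h
  have h2 : ∀ a b, Tendsto (fun y => (syl (f y) (g y))⁻¹ a b) (𝓝 x)
      (𝓝 ((syl (f x) (g x))⁻¹ a b)) := fun a b => tendsto_pi_nhds.1 (tendsto_pi_nhds.1 h1 a) b
  refine tendsto_pi_nhds.2 fun i => tendsto_pi_nhds.2 fun j => ?_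
  simp only [sol, Matrix.of_apply, Matrix.mulVec, dotProduct]
  exact tendsto_finsetSum _ fun k _ => (h2 _ _).mul ((hR.matrix_elem _ _).tendsto x)

open Filter Topology in
lemma continuousAt_glue (d : Quad α × Quad β)
    (hd : (syl d.1.1 d.2.1).det ≠ 0) (hd' : (syl d.2.1 d.1.1).det ≠ 0) :
    ContinuousAt glue d := by
  unfold glue
  have p1 : Continuous fun d : Quad α × Quad β => d.1.1 := continuous_fst.comp continuous_fst
  have p2 : Continuous fun d : Quad α × Quad β => d.2.1 := continuous_fst.comp continuous_snd
  have p3 : Continuous fun d : Quad α × Quad β => d.1.2.1 :=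
    continuous_fst.comp (continuous_snd.comp continuous_fst)
  have p4 : Continuous fun d : Quad α × Quad β => d.2.2.1 :=
    continuous_fst.comp (continuous_snd.comp continuous_snd)
  have p5 : Continuous fun d : Quad α × Quad β => d.1.2.2.1 :=
    continuous_fst.comp (continuous_snd.comp (continuous_snd.comp continuous_fst))
  have p6 : Continuous fun d : Quad α × Quad β => d.2.2.2.1 :=
    continuous_fst.comp (continuous_snd.comp (continuous_snd.comp continuous_snd))
  have p7 : Continuous fun d : Quad α × Quad β => d.1.2.2.2 :=
    continuous_snd.comp (continuous_snd.comp (continuous_snd.comp continuous_fst))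
  have p8 : Continuous fun d : Quad α × Quad β => d.2.2.2.2 :=
    continuous_snd.comp (continuous_snd.comp (continuous_snd.comp continuous_snd))
  refine ContinuousAt.prodMk ?_ (ContinuousAt.prodMk ?_ (ContinuousAt.prodMk ?_ ?_))
  · exact (Continuous.matrix_fromBlocks p1 continuous_const continuous_const p2).continuousAt
  · have s1 := continuousAt_sol _ _ _ p1 p2 (p5.matrix_vecMulVec p8).neg d hd
    have s2 := continuousAt_sol _ _ _ p2 p1 (p6.matrix_vecMulVec p7).neg d hd'
    refine tendsto_pi_nhds.2 fun i => tendsto_pi_nhds.2 fun j => ?_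
    rcases i with i | i <;> rcases j with j | j
    · exact (p3.matrix_elem i j).continuousAt
    · exact tendsto_pi_nhds.1 (tendsto_pi_nhds.1 s1 i) j
    · exact tendsto_pi_nhds.1 (tendsto_pi_nhds.1 s2 i) j
    · exact (p4.matrix_elem i j).continuousAt
  · refine tendsto_pi_nhds.2 fun i => ?_
    rcases i with i | i
    · exact ((continuous_apply i).comp p5).continuousAt
    · exact ((continuous_apply i).comp p6).continuousAt
  · refine tendsto_pi_nhds.2 fun i => ?_
    rcases i with i | i
    · exact ((continuous_apply i).comp p7).continuousAt
    · exact ((continuous_apply i).comp p8).continuousAt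

open Filter Topology in
lemma glue_closure (d : Quad α × Quad β) (h1 : d.1 ∈ closure (SimpleCM α))
    (h2 : d.2 ∈ closure (SimpleCM β))
    (hd : (syl d.1.1 d.2.1).det ≠ 0) (hd' : (syl d.2.1 d.1.1).det ≠ 0) :
    glue d ∈ closure (SimpleCM (α ⊕ β)) := by
  have hmem : d ∈ closure (SimpleCM α ×ˢ SimpleCM β) := by
    rw [closure_prod_eq]; exact ⟨h1, h2⟩
  have : (𝓝[SimpleCM α ×ˢ SimpleCM β] d).NeBot := mem_closure_iff_nhdsWithin_neBot.1 hmem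
  have ht : Tendsto glue (𝓝[SimpleCM α ×ˢ SimpleCM β] d) (𝓝 (glue d)) :=
    (continuousAt_glue d hd hd').mono_left nhdsWithin_le_nhds
  refine mem_closure_of_tendsto ht ?_
  have c1 : Continuous fun d : Quad α × Quad β => (syl d.1.1 d.2.1).det :=
    (continuous_syl _ _ (continuous_fst.comp continuous_fst)
      (continuous_fst.comp continuous_snd)).matrix_det
  have c2 : Continuous fun d : Quad α × Quad β => (syl d.2.1 d.1.1).det :=
    (continuous_syl _ _ (continuous_fst.comp continuous_snd)
      (continuous_fst.comp continuous_fst)).matrix_det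
  filter_upwards [self_mem_nhdsWithin,
    nhdsWithin_le_nhds (c1.continuousAt.eventually_ne hd),
    nhdsWithin_le_nhds (c2.continuousAt.eventually_ne hd')] with y hy e1 e2
  exact glue_mem y hy.1 hy.2 e1 e2

lemma block_closure (Q1 Z11 : Matrix α α ℂ) (Z12 : Matrix α β ℂ) (Z21 : Matrix β α ℂ)
    (Q2 Z22 : Matrix β β ℂ) (v1 w1 : α → ℂ) (v2 w2 : β → ℂ)
    (hcm : IsCM (fromBlocks Q1 0 0 Q2) (fromBlocks Z11 Z12 Z21 Z22) (Sum.elim v1 v2)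
      (Sum.elim w1 w2))
    (hα : ∀ Q Z v w, IsCM Q Z v w → ((Q, Z, v, w) : Quad α) ∈ closure (SimpleCM α))
    (hβ : ∀ Q Z v w, IsCM Q Z v w → ((Q, Z, v, w) : Quad β) ∈ closure (SimpleCM β))
    (hd : (syl Q1 Q2).det ≠ 0) (hd' : (syl Q2 Q1).det ≠ 0) :
    ((fromBlocks Q1 0 0 Q2, fromBlocks Z11 Z12 Z21 Z22, Sum.elim v1 v2, Sum.elim w1 w2) :
      Quad (α ⊕ β)) ∈ closure (SimpleCM (α ⊕ β)) := by
  obtain ⟨a1, a2, a3, a4⟩ := (isCM_blocks _ _ _ _ _ _ _ _ _ _).1 hcm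
  have := glue_closure ((Q1, Z11, v1, w1), (Q2, Z22, v2, w2)) (hα _ _ _ _ a1) (hβ _ _ _ _ a4) hd hd'
  have b1 : sol Q1 Q2 (-vecMulVec v1 w2) = Z12 := by
    rw [← sub_eq_zero]
    refine syl_inj _ _ hd _ ?_
    have := sol_spec Q1 Q2 (-vecMulVec v1 w2) hd
    rw [← a2] at this ⊢
    rw [Matrix.mul_sub, Matrix.sub_mul]
    exact sub_eq_sub_iff_sub_eq_sub.1 this
  have b2 : sol Q2 Q1 (-vecMulVec v2 w1) = Z21 := by
    rw [← sub_eq_zero]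
    refine syl_inj _ _ hd' _ ?_
    have := sol_spec Q2 Q1 (-vecMulVec v2 w1) hd'
    rw [← a3] at this ⊢
    rw [Matrix.mul_sub, Matrix.sub_mul]
    exact sub_eq_sub_iff_sub_eq_sub.1 this
  simp only [glue, b1, b2] at this
  exact this
end blocks


lemma fromBlocks_diag_pow {α β : Type} [Fintype α] [DecidableEq α] [Fintype β] [DecidableEq β]
    (A : Matrix α α ℂ) (B : Matrix β β ℂ) (n : ℕ) :
    (fromBlocks A 0 0 B) ^ n = fromBlocks (A ^ n) 0 0 (B ^ n) := by
  induction n with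
  | zero => simp
  | succ n ih => rw [pow_succ, ih, Matrix.fromBlocks_multiply]; simp [pow_succ]

lemma intertwine_pow {α β : Type} [Fintype α] [DecidableEq α] [Fintype β] [DecidableEq β]
    (A : Matrix α α ℂ) (B : Matrix β β ℂ) (X : Matrix α β ℂ) (h : A * X = X * B) (n : ℕ) :
    A ^ n * X = X * B ^ n := by
  induction n with
  | zero => simp
  | succ n ih => rw [pow_succ, Matrix.mul_assoc, h, ← Matrix.mul_assoc, ih, Matrix.mul_assoc,
      ← pow_succ]

lemma fitting (g : Module.End ℂ (ι → ℂ)) (hker : ∃ x, x ≠ 0 ∧ g x = 0) (hnil : ¬ IsNilpotent g) :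
    ∃ (a b n : ℕ) (B : Module.Basis (Fin a ⊕ Fin b) ℂ (ι → ℂ)) (M1 : Matrix (Fin a) (Fin a) ℂ)
      (M2 : Matrix (Fin b) (Fin b) ℂ), 0 < a ∧ 0 < b ∧
      LinearMap.toMatrix B B g = fromBlocks M1 0 0 M2 ∧ M1 ^ n = 0 ∧ M2.det ≠ 0 := by
  obtain ⟨n, hn1, hn⟩ := ((Filter.eventually_ge_atTop 1).and
    (LinearMap.eventually_isCompl_ker_pow_range_pow g)).exists
  set p := LinearMap.ker (g ^ n) with hp
  set r := LinearMap.range (g ^ n) with hr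
  set B : Module.Basis (Fin (Module.finrank ℂ p) ⊕ Fin (Module.finrank ℂ r)) ℂ (ι → ℂ) :=
    ((Module.finBasis ℂ p).prod (Module.finBasis ℂ r)).map (Submodule.prodEquivOfIsCompl p r hn)
    with hB
  have F1 : ∀ Y, Y ∈ p ↔ ∀ j, B.repr Y (Sum.inr j) = 0 := by
    intro Y
    rw [← Submodule.prodEquivOfIsCompl_symm_apply_snd_eq_zero _ _ hn]
    have key : ∀ j, B.repr Y (Sum.inr j) = (Module.finBasis ℂ r).repr
        ((Submodule.prodEquivOfIsCompl p r hn).symm Y).2 j := fun j => rfl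
    constructor
    · intro h j
      rw [key, h, map_zero, Finsupp.zero_apply]
    · intro h
      apply (Module.finBasis ℂ r).repr.injective
      ext j
      rw [← key, h, map_zero, Finsupp.zero_apply]
  have F2 : ∀ Y, Y ∈ r ↔ ∀ j, B.repr Y (Sum.inl j) = 0 := by
    intro Y
    rw [← Submodule.prodEquivOfIsCompl_symm_apply_fst_eq_zero _ _ hn]
    have key : ∀ j, B.repr Y (Sum.inl j) = (Module.finBasis ℂ p).repr
        ((Submodule.prodEquivOfIsCompl p r hn).symm Y).1 j := fun j => rfl
    constructor
    · intro h j
      rw [key, h, map_zero, Finsupp.zero_apply]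
    · intro h
      apply (Module.finBasis ℂ p).repr.injective
      ext j
      rw [← key, h, map_zero, Finsupp.zero_apply]
  have hpg : ∀ Y ∈ p, g Y ∈ p := by
    intro Y hY
    rw [hp, LinearMap.mem_ker] at hY ⊢
    rw [← Module.End.mul_apply, ← pow_succ, pow_succ', Module.End.mul_apply, hY, map_zero]
  have hrg : ∀ Y ∈ r, g Y ∈ r := by
    rintro Y ⟨X, rfl⟩
    exact ⟨g X, by rw [← Module.End.mul_apply, ← Module.End.mul_apply, ← pow_succ, pow_succ']⟩
  have hBp : ∀ i, B (Sum.inl i) ∈ p := fun i => (F1 _).2 fun j => by simp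
  have hBr : ∀ i, B (Sum.inr i) ∈ r := fun i => (F2 _).2 fun j => by simp
  set M := LinearMap.toMatrix B B g with hM
  have hMb : M = fromBlocks M.toBlocks₁₁ 0 0 M.toBlocks₂₂ := by
    conv_lhs => rw [← Matrix.fromBlocks_toBlocks M]
    congr 1
    · ext i j
      change LinearMap.toMatrix B B g (Sum.inl i) (Sum.inr j) = 0
      rw [LinearMap.toMatrix_apply]
      exact (F2 _).1 (hrg _ (hBr j)) i
    · ext i j
      change LinearMap.toMatrix B B g (Sum.inr i) (Sum.inl j) = 0
      rw [LinearMap.toMatrix_apply]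
      exact (F1 _).1 (hpg _ (hBp j)) i
  refine ⟨_, _, n, B, M.toBlocks₁₁, M.toBlocks₂₂, ?_, ?_, hMb, ?_, ?_⟩
  · obtain ⟨x, hx0, hx⟩ := hker
    have hxp : x ∈ p := by
      rw [hp, LinearMap.mem_ker]
      obtain ⟨k, rfl⟩ : ∃ k, n = k + 1 := ⟨n - 1, by omega⟩
      rw [pow_succ, Module.End.mul_apply, hx, map_zero]
    have : Nontrivial p := ⟨⟨⟨x, hxp⟩, 0, fun h => hx0 (congrArg Subtype.val h)⟩⟩
    exact Module.finrank_pos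
  · rw [Nat.pos_iff_ne_zero]
    intro h
    rw [Submodule.finrank_eq_zero, hr, LinearMap.range_eq_bot] at h
    exact hnil ⟨n, h⟩
  · have h1 : M ^ n = LinearMap.toMatrix B B (g ^ n) := by
      rw [LinearMap.toMatrix_pow]
    rw [hMb, fromBlocks_diag_pow] at h1
    ext i j
    have := congrFun (congrFun h1 (Sum.inl i)) (Sum.inl j)
    rw [Matrix.fromBlocks_apply₁₁, LinearMap.toMatrix_apply, LinearMap.mem_ker.1 (hBp j)] at this
    simpa using this
  · intro h0
    obtain ⟨x, hx0, hx⟩ := Matrix.exists_mulVec_eq_zero_iff.2 h0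
    set Y := B.equivFun.symm (Sum.elim (0 : Fin (Module.finrank ℂ p) → ℂ) x) with hY
    have hYr : ∀ k, B.repr Y k = Sum.elim (0 : Fin (Module.finrank ℂ p) → ℂ) x k := by
      intro k
      rw [← Module.Basis.equivFun_apply, hY, LinearEquiv.apply_symm_apply]
    have hYrr : ⇑(B.repr Y) = Sum.elim (0 : Fin (Module.finrank ℂ p) → ℂ) x := funext hYr
    have hgY : g Y = 0 := by
      apply B.repr.injective
      rw [map_zero]
      apply DFunLike.coe_injective
      rw [← LinearMap.toMatrix_mulVec_repr B B g Y, hYrr, ← hM, hMb, Matrix.fromBlocks_mulVec]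
      ext (k | k)
      · simp
      · simpa using congrFun hx k
    have hYp : Y ∈ p := by
      rw [hp, LinearMap.mem_ker]
      obtain ⟨k, rfl⟩ : ∃ k, n = k + 1 := ⟨n - 1, by omega⟩
      rw [pow_succ, Module.End.mul_apply, hgY, map_zero]
    apply hx0
    ext k
    have := (F1 Y).1 hYp k
    rw [hYr] at this
    exact this

lemma syl_nil {α β : Type} [Fintype α] [DecidableEq α] [Fintype β] [DecidableEq β]
    (A : Matrix α α ℂ) (B : Matrix β β ℂ) (c : ℂ) (n : ℕ) (hA : A ^ n = 0) (hB : B.det ≠ 0) :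
    (syl (A + c • 1) (B + c • 1)).det ≠ 0 ∧ (syl (B + c • 1) (A + c • 1)).det ≠ 0 := by
  have hu : IsUnit (B ^ n).det := by rw [Matrix.det_pow]; exact (isUnit_iff_ne_zero.2 hB).pow n
  constructor
  · refine syl_det_ne _ _ fun X hX => ?_
    rw [Matrix.add_mul, Matrix.mul_add, Matrix.smul_mul, Matrix.mul_smul, Matrix.one_mul,
      Matrix.mul_one, add_left_inj] at hX
    have h1 := intertwine_pow A B X hX n
    rw [hA, Matrix.zero_mul] at h1
    calc X = X * B ^ n * (B ^ n)⁻¹ := by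
          rw [Matrix.mul_assoc, Matrix.mul_nonsing_inv _ hu, Matrix.mul_one]
      _ = 0 := by rw [← h1, Matrix.zero_mul]
  · refine syl_det_ne _ _ fun X hX => ?_
    rw [Matrix.add_mul, Matrix.mul_add, Matrix.smul_mul, Matrix.mul_smul, Matrix.one_mul,
      Matrix.mul_one, add_left_inj] at hX
    have h1 := intertwine_pow B A X hX n
    rw [hA, Matrix.mul_zero] at h1
    calc X = (B ^ n)⁻¹ * (B ^ n * X) := by
          rw [← Matrix.mul_assoc, Matrix.nonsing_inv_mul _ hu, Matrix.one_mul]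
      _ = 0 := by rw [h1, Matrix.mul_zero]

lemma exists_block (Q : Matrix ι ι ℂ) (c : ℂ) (hker : ∃ x, x ≠ 0 ∧ (Q - c • 1) *ᵥ x = 0)
    (hnil : ¬ IsNilpotent (Q - c • 1)) :
    ∃ (a b : ℕ) (_ : Fin a ⊕ Fin b ≃ ι) (C : Matrix ι (Fin a ⊕ Fin b) ℂ)
      (C' : Matrix (Fin a ⊕ Fin b) ι ℂ)
      (Q1 : Matrix (Fin a) (Fin a) ℂ) (Q2 : Matrix (Fin b) (Fin b) ℂ),
      a < Fintype.card ι ∧ b < Fintype.card ι ∧ C * C' = 1 ∧ C' * C = 1 ∧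
      C' * Q * C = fromBlocks Q1 0 0 Q2 ∧ (syl Q1 Q2).det ≠ 0 ∧ (syl Q2 Q1).det ≠ 0 := by
  obtain ⟨a, b, n, B, M1, M2, ha, hb, hM, h1, h2⟩ := fitting (Matrix.toLin' (Q - c • 1)) hker
    (by
      rintro ⟨k, hk⟩
      refine hnil ⟨k, ?_⟩
      rw [← Matrix.toLin'_pow] at hk
      exact (LinearEquiv.map_eq_zero_iff _).1 hk)
  have e : Fin a ⊕ Fin b ≃ ι := B.indexEquiv (Pi.basisFun ℂ ι)
  have hc := Fintype.card_congr e
  rw [Fintype.card_sum, Fintype.card_fin, Fintype.card_fin] at hc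
  obtain ⟨s1, s2⟩ := syl_nil M1 M2 c n h1 h2
  have i1 : B.toMatrix (Pi.basisFun ℂ ι) * (Pi.basisFun ℂ ι).toMatrix B = 1 :=
    Module.Basis.toMatrix_mul_toMatrix_flip _ _
  have i2 : (Pi.basisFun ℂ ι).toMatrix B * B.toMatrix (Pi.basisFun ℂ ι) = 1 :=
    Module.Basis.toMatrix_mul_toMatrix_flip _ _
  refine ⟨a, b, e, (Pi.basisFun ℂ ι).toMatrix B, B.toMatrix (Pi.basisFun ℂ ι), M1 + c • 1,
    M2 + c • 1, by omega, by omega, i2, i1, ?_, s1, s2⟩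
  have h3 := basis_toMatrix_mul_linearMap_toMatrix_mul_basis_toMatrix B (Pi.basisFun ℂ ι)
    B (Pi.basisFun ℂ ι) (Matrix.toLin' (Q - c • 1))
  rw [hM, ← Matrix.toLin_eq_toLin', LinearMap.toMatrix_toLin] at h3
  have h4 : Q = (Q - c • 1) + c • 1 := by simp
  rw [h4, Matrix.mul_add, Matrix.add_mul, h3, Matrix.mul_smul, Matrix.smul_mul, Matrix.mul_one,
    i1, ← Matrix.fromBlocks_one, Matrix.fromBlocks_smul, Matrix.fromBlocks_add]
  simp

lemma nonscalar_closure (Q Z : Matrix ι ι ℂ) (v w : ι → ℂ) (hcm : IsCM Q Z v w)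
    (ih : ∀ a < Fintype.card ι, ∀ Q Z v w, IsCM Q Z v w →
      ((Q, Z, v, w) : Quad (Fin a)) ∈ closure (SimpleCM (Fin a)))
    (c : ℂ) (hker : ∃ x, x ≠ 0 ∧ (Q - c • 1) *ᵥ x = 0) (hnil : ¬ IsNilpotent (Q - c • 1)) :
    ((Q, Z, v, w) : Quad ι) ∈ closure (SimpleCM ι) := by
  obtain ⟨a, b, e, C, C', Q1, Q2, ha, hb, h, h', hQ, s1, s2⟩ := exists_block Q c hker hnil
  have h1 := hcm.conj C' C h' h
  set Z' := C' * Z * C with hZ'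
  set v' := C' *ᵥ v with hv'
  set w' := w ᵥ* C with hw'
  have eZ : fromBlocks Z'.toBlocks₁₁ Z'.toBlocks₁₂ Z'.toBlocks₂₁ Z'.toBlocks₂₂ = Z' :=
    Matrix.fromBlocks_toBlocks Z'
  have ev : Sum.elim (v' ∘ Sum.inl) (v' ∘ Sum.inr) = v' := Sum.elim_comp_inl_inr v'
  have ew : Sum.elim (w' ∘ Sum.inl) (w' ∘ Sum.inr) = w' := Sum.elim_comp_inl_inr w'
  have h2 := block_closure Q1 Z'.toBlocks₁₁ Z'.toBlocks₁₂ Z'.toBlocks₂₁ Q2 Z'.toBlocks₂₂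
    (v' ∘ Sum.inl) (w' ∘ Sum.inl) (v' ∘ Sum.inr) (w' ∘ Sum.inr)
    (by rw [eZ, ev, ew, ← hQ]; exact h1) (ih a ha) (ih b hb) s1 s2
  rw [eZ, ev, ew, ← hQ] at h2
  have h3 := closure_conj e _ h2 C C' h h'
  have f : ∀ A : Matrix ι ι ℂ, C * (C' * A * C) * C' = A := by
    intro A
    calc C * (C' * A * C) * C' = (C * C') * A * (C * C') := by simp only [Matrix.mul_assoc]
      _ = A := by simp [h]
  simp only [hZ', hv', hw', f, Matrix.mulVec_mulVec, Matrix.vecMul_vecMul, h, Matrix.one_mulVec,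
    Matrix.vecMul_one] at h3
  exact h3


open Filter Topology in
lemma quartic_zero (a b c d e : ℂ)
    (h : ∀ᶠ t in 𝓝[≠] (0 : ℂ), a + b * t + c * t ^ 2 + d * t ^ 3 + e * t ^ 4 = 0) :
    a = 0 ∧ b = 0 ∧ c = 0 ∧ d = 0 ∧ e = 0 := by
  set P : ℂ[X] := C a + C b * X + C c * X ^ 2 + C d * X ^ 3 + C e * X ^ 4 with hP
  have hev : ∀ t, P.eval t = a + b * t + c * t ^ 2 + d * t ^ 3 + e * t ^ 4 := by
    intro t; simp [hP]
  have hinf : Set.Infinite {t | P.IsRoot t} := by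
    have h1 : insert 0 {t | P.IsRoot t} ∈ 𝓝 (0 : ℂ) := by
      rw [eventually_nhdsWithin_iff] at h
      filter_upwards [h] with t ht
      by_cases h0 : t = 0
      · exact Or.inl h0
      · exact Or.inr (by
          change P.eval t = 0
          rw [hev]; exact ht h0)
    have h2 := infinite_of_mem_nhds (0 : ℂ) h1
    exact fun hf => h2 (hf.insert 0)
  have h0 := Polynomial.eq_zero_of_infinite_isRoot P hinf
  have hc : ∀ n, P.coeff n = 0 := by intro n; rw [h0, coeff_zero]
  refine ⟨?_, ?_, ?_, ?_, ?_⟩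
  · simpa [hP, coeff_X, coeff_C, coeff_X_pow] using hc 0
  · simpa [hP, coeff_X, coeff_C, coeff_X_pow] using hc 1
  · simpa [hP, coeff_X, coeff_C, coeff_X_pow] using hc 2
  · simpa [hP, coeff_X, coeff_C, coeff_X_pow] using hc 3
  · simpa [hP, coeff_X, coeff_C, coeff_X_pow] using hc 4

lemma sn_trace (Q : Matrix ι ι ℂ) (hN : (Fintype.card ι : ℂ) ≠ 0)
    (h : ∃ c : ℂ, IsNilpotent (Q - c • 1)) (k : ℕ) (hk : k ≠ 0) :
    ((Q - (Q.trace / Fintype.card ι) • 1) ^ k).trace = 0 := by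
  obtain ⟨c, hc⟩ := h
  have h1 := (Matrix.isNilpotent_trace_of_isNilpotent hc).eq_zero
  rw [Matrix.trace_sub, Matrix.trace_smul, Matrix.trace_one, smul_eq_mul, sub_eq_zero] at h1
  have h2 : Q.trace / Fintype.card ι = c := by rw [h1]; field_simp
  rw [h2]
  exact (Matrix.isNilpotent_trace_of_isNilpotent (hc.pow_of_pos hk)).eq_zero

lemma tr_exp2 (A B : Matrix ι ι ℂ) (t : ℂ) : ((A + t • B) ^ 2).trace =
    (A * A).trace + (A * B + B * A).trace * t + (B * B).trace * t ^ 2 + 0 * t ^ 3 + 0 * t ^ 4 := by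
  rw [pow_two]
  simp only [Matrix.add_mul, Matrix.mul_add, Matrix.smul_mul, Matrix.mul_smul, Matrix.trace_add,
    Matrix.trace_smul, smul_eq_mul]
  ring

lemma tr_exp3 (A B : Matrix ι ι ℂ) (t : ℂ) : ((A + t • B) ^ 3).trace =
    (A * A * A).trace + (A * A * B + A * B * A + B * A * A).trace * t
      + (A * B * B + B * A * B + B * B * A).trace * t ^ 2 + (B * B * B).trace * t ^ 3
      + 0 * t ^ 4 := by
  rw [pow_succ, pow_two]
  simp only [Matrix.add_mul, Matrix.mul_add, Matrix.smul_mul, Matrix.mul_smul, Matrix.trace_add,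
    Matrix.trace_smul, smul_eq_mul]
  ring

lemma tr_exp4 (A B : Matrix ι ι ℂ) (t : ℂ) : ((A + t • B) ^ 4).trace =
    (A * A * A * A).trace + (A * A * A * B + A * A * B * A + A * B * A * A + B * A * A * A).trace * t
      + (A * A * B * B + A * B * A * B + A * B * B * A + B * A * A * B + B * A * B * A
        + B * B * A * A).trace * t ^ 2
      + (B * B * B * A + B * B * A * B + B * A * B * B + A * B * B * B).trace * t ^ 3
      + (B * B * B * B).trace * t ^ 4 := by
  rw [pow_succ, pow_succ, pow_two]
  simp only [Matrix.add_mul, Matrix.mul_add, Matrix.smul_mul, Matrix.mul_smul, Matrix.trace_add,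
    Matrix.trace_smul, smul_eq_mul]
  ring

lemma cm_trace {Q Z : Matrix ι ι ℂ} {v w : ι → ℂ} (h : IsCM Q Z v w) :
    w ⬝ᵥ v = Fintype.card ι := by
  have h1 := congrArg Matrix.trace h
  rw [Matrix.trace_sub, Matrix.trace_sub, Matrix.trace_mul_comm Q Z, sub_self, Matrix.trace_one,
    Matrix.trace_vecMulVec, dotProduct_comm] at h1
  exact (sub_eq_zero.1 h1.symm).symm

lemma cm_trace_sq {Q Z : Matrix ι ι ℂ} {v w : ι → ℂ} (h : IsCM Q Z v w)
    (h0 : ((Q * Z - Z * Q) * (Q * Z - Z * Q)).trace = 0) :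
    (Fintype.card ι : ℂ) ^ 2 - Fintype.card ι = 0 := by
  have ht := cm_trace h
  rw [h, Matrix.sub_mul, Matrix.mul_sub, Matrix.mul_sub, Matrix.one_mul, Matrix.mul_one,
    Matrix.vecMulVec_mul_vecMulVec, Matrix.one_mul] at h0
  simp only [Matrix.trace_sub, Matrix.trace_one, Matrix.trace_vecMulVec, dotProduct_smul,
    smul_dotProduct, smul_eq_mul, dotProduct_comm v w, ht] at h0
  linear_combination h0

open Filter Topology in
lemma contra_aux (Q Z : Matrix ι ι ℂ) (v w : ι → ℂ) (hcm : IsCM Q Z v w) (hN : 2 ≤ Fintype.card ι)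
    (Z0 : Matrix ι ι ℂ) (hZ0 : Z0 = Z - (Z.trace / Fintype.card ι) • 1)
    (h1 : ∀ᶠ t in 𝓝[≠] (0 : ℂ), ∃ c : ℂ, IsNilpotent (Q + t • Z0 - c • 1))
    (h2 : ∀ᶠ t in 𝓝[≠] (0 : ℂ), ∃ c : ℂ, IsNilpotent (Q + t • (Z0 * Z0) - c • 1)) : False := by
  have hNc : (Fintype.card ι : ℂ) ≠ 0 := by
    rw [Nat.cast_ne_zero]; omega
  set Q0 := Q - (Q.trace / Fintype.card ι) • (1 : Matrix ι ι ℂ) with hQ0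
  have tZ0 : Z0.trace = 0 := by
    rw [hZ0, Matrix.trace_sub, Matrix.trace_smul, Matrix.trace_one, smul_eq_mul]; field_simp; ring
  have k1 : ∀ k : ℕ, k ≠ 0 → ∀ᶠ t in 𝓝[≠] (0 : ℂ), ((Q0 + t • Z0) ^ k).trace = 0 := by
    intro k hk
    filter_upwards [h1] with t ht
    have := sn_trace _ hNc ht k hk
    rw [Matrix.trace_add, Matrix.trace_smul, tZ0, smul_zero, add_zero, add_sub_right_comm] at this
    exact this
  have a2 := k1 2 (by norm_num)
  have a4 := k1 4 (by norm_num)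
  simp only [tr_exp2] at a2
  simp only [tr_exp4] at a4
  obtain ⟨-, -, c2, -, -⟩ := quartic_zero _ _ _ _ _ a2
  obtain ⟨-, -, c4, -, -⟩ := quartic_zero _ _ _ _ _ a4
  have a3 : ∀ᶠ t in 𝓝[≠] (0 : ℂ), ((Q0 + t • (Z0 * Z0)) ^ 3).trace = 0 := by
    filter_upwards [h2] with t ht
    have := sn_trace _ hNc ht 3 (by norm_num)
    rw [Matrix.trace_add, Matrix.trace_smul, c2, smul_zero, add_zero, add_sub_right_comm] at this
    exact this
  simp only [tr_exp3] at a3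
  obtain ⟨-, c3, -, -, -⟩ := quartic_zero _ _ _ _ _ a3
  have hc : Q * Z - Z * Q = Q0 * Z0 - Z0 * Q0 := by
    rw [hQ0, hZ0]
    generalize Q.trace / (Fintype.card ι : ℂ) = a
    generalize Z.trace / (Fintype.card ι : ℂ) = b
    simp only [Matrix.sub_mul, Matrix.mul_sub, Matrix.smul_mul, Matrix.mul_smul, Matrix.one_mul,
      Matrix.mul_one, smul_sub, smul_smul, mul_comm a b]
    abel
  have hfin := cm_trace_sq hcm (by
    rw [hc]
    have r1 : (Q0 * Z0 * Z0 * Q0).trace = (Q0 * Q0 * Z0 * Z0).trace := by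
      rw [Matrix.trace_mul_comm]; simp only [Matrix.mul_assoc]
    have r2 : (Z0 * Q0 * Q0 * Z0).trace = (Q0 * Q0 * Z0 * Z0).trace := by
      rw [Matrix.mul_assoc, Matrix.mul_assoc, Matrix.trace_mul_comm]; simp only [Matrix.mul_assoc]
    have r3 : (Z0 * Q0 * Z0 * Q0).trace = (Q0 * Z0 * Q0 * Z0).trace := by
      rw [Matrix.trace_mul_comm]; simp only [Matrix.mul_assoc]
    have r4 : (Z0 * Z0 * Q0 * Q0).trace = (Q0 * Q0 * Z0 * Z0).trace := by
      rw [Matrix.mul_assoc, Matrix.trace_mul_comm]; simp only [Matrix.mul_assoc]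
    have r5 : (Q0 * Q0 * (Z0 * Z0)).trace = (Q0 * Q0 * Z0 * Z0).trace := by
      simp only [Matrix.mul_assoc]
    have r6 : (Q0 * (Z0 * Z0) * Q0).trace = (Q0 * Q0 * Z0 * Z0).trace := by
      rw [← r1]; simp only [Matrix.mul_assoc]
    simp only [← Matrix.mul_assoc] at c3
    simp only [Matrix.trace_add, r1, r2, r3, r4] at c3 c4
    simp only [Matrix.sub_mul, Matrix.mul_sub, ← Matrix.mul_assoc, Matrix.trace_sub, r1, r2, r3, r4]
    linear_combination c4 - 2 * c3)
  have : (Fintype.card ι : ℂ) * ((Fintype.card ι : ℂ) - 1) = 0 := by linear_combination hfin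
  rcases mul_eq_zero.1 this with h | h
  · exact hNc h
  · rw [sub_eq_zero] at h
    have : Fintype.card ι = 1 := by exact_mod_cast h
    omega

lemma isCM_add {Q Z : Matrix ι ι ℂ} {v w : ι → ℂ} (h : IsCM Q Z v w) (t : ℂ) (Y : Matrix ι ι ℂ)
    (hY : Commute Y Z) : IsCM (Q + t • Y) Z v w := by
  unfold IsCM at *
  rw [Matrix.add_mul, Matrix.mul_add, Matrix.smul_mul, Matrix.mul_smul, hY.eq, ← h]
  abel

open Filter Topology in
lemma tendsto_pert (Q Z Y : Matrix ι ι ℂ) (v w : ι → ℂ) :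
    Tendsto (fun t : ℂ => ((Q + t • Y, Z, v, w) : Quad ι)) (𝓝[≠] 0) (𝓝 (Q, Z, v, w)) := by
  have : Continuous (fun t : ℂ => ((Q + t • Y, Z, v, w) : Quad ι)) :=
    (continuous_const.add (continuous_id.smul continuous_const)).prodMk continuous_const
  have h := this.tendsto 0
  simp only [zero_smul, add_zero] at h
  exact h.mono_left nhdsWithin_le_nhds

open Filter Topology in
theorem cm_closure (n : ℕ) : ∀ (ι : Type) [Fintype ι] [DecidableEq ι], Fintype.card ι = n →
    ∀ (Q Z : Matrix ι ι ℂ) (v w : ι → ℂ), IsCM Q Z v w →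
    ((Q, Z, v, w) : Quad ι) ∈ closure (SimpleCM ι) := by
  induction n using Nat.strong_induction_on with
  | _ n ih =>
    intro ι _ _ hn Q Z v w hcm
    by_cases hN : Fintype.card ι ≤ 1
    · refine subset_closure ⟨hcm, ?_⟩
      have : Subsingleton ι := Fintype.card_le_one_iff_subsingleton.1 hN
      refine ⟨fun i => Q i i, 1, 1, Function.injective_of_subsingleton _, by simp, by simp, ?_⟩
      ext i j
      obtain rfl := Subsingleton.elim i j
      simp
    push Not at hN
    have key : ∀ Q : Matrix ι ι ℂ, IsCM Q Z v w → (¬ ∃ c : ℂ, IsNilpotent (Q - c • 1)) →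
        ((Q, Z, v, w) : Quad ι) ∈ closure (SimpleCM ι) := by
      intro Q hcm hns
      have : Nonempty ι := Fintype.card_pos_iff.1 (by omega)
      obtain ⟨c, hc⟩ := Module.End.exists_eigenvalue (Matrix.toLin' Q)
      obtain ⟨x, hx⟩ := hc.exists_hasEigenvector
      refine nonscalar_closure Q Z v w hcm (fun a ha => ih a (hn ▸ ha) (Fin a) (by simp)) c
        ⟨x, hx.2, ?_⟩ fun h => hns ⟨c, h⟩
      have := hx.apply_eq_smul
      rw [Matrix.toLin'_apply] at this
      rw [Matrix.sub_mulVec, this, Matrix.smul_mulVec, Matrix.one_mulVec, sub_self]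
    set Z0 := Z - (Z.trace / Fintype.card ι) • (1 : Matrix ι ι ℂ) with hZ0
    have hcZ : Commute Z0 Z := by
      rw [hZ0]
      exact (Commute.refl Z).sub_left ((Commute.one_left Z).smul_left _)
    have freq : ∀ Y : Matrix ι ι ℂ, Commute Y Z →
        (∃ᶠ t in 𝓝[≠] (0 : ℂ), ¬ ∃ c : ℂ, IsNilpotent (Q + t • Y - c • 1)) →
        ((Q, Z, v, w) : Quad ι) ∈ closure (SimpleCM ι) := by
      intro Y hY hf
      rw [← closure_closure]
      exact mem_closure_of_frequently_of_tendsto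
        (hf.mono fun t ht => key _ (isCM_add hcm t Y hY) ht) (tendsto_pert Q Z Y v w)
    by_cases h1 : ∃ᶠ t in 𝓝[≠] (0 : ℂ), ¬ ∃ c : ℂ, IsNilpotent (Q + t • Z0 - c • 1)
    · exact freq Z0 hcZ h1
    by_cases h2 : ∃ᶠ t in 𝓝[≠] (0 : ℂ), ¬ ∃ c : ℂ, IsNilpotent (Q + t • (Z0 * Z0) - c • 1)
    · exact freq (Z0 * Z0) (hcZ.mul_left hcZ) h2
    rw [not_frequently] at h1 h2
    simp only [not_not] at h1 h2
    exact (contra_aux Q Z v w hcm hN Z0 hZ0 h1 h2).elim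

theorem cm_hasP {Q Z : Matrix ι ι ℂ} {v w : ι → ℂ} (h : IsCM Q Z v w) : HasP Q Z v w :=
  HasP_of_closure _ (cm_closure _ ι rfl Q Z v w h)


/-! ### Part E: reality -/

theorem star_real_iff (x : ℂ) : starRingEnd ℂ x = x ↔ ∃ r : ℝ, x = (r : ℂ) := by
  constructor
  · intro h
    exact ⟨x.re, (Complex.conj_eq_iff_re.mp h).symm⟩
  · rintro ⟨r, rfl⟩
    exact Complex.conj_ofReal r

noncomputable def cT (q μ : ι → ℂ) (u z : ℂ) (τ σ : Equiv.Perm ι) : ℂ :=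
  ∏ k, if τ k = k then 1 - (u - q k) * (z - μ (σ.symm k)) else 1

theorem cT_symm (q μ : ι → ℂ) (u z : ℂ) (τ σ : Equiv.Perm ι) :
    cT q μ u z τ⁻¹ (τ * σ) = cT q μ u z τ σ := by
  unfold cT
  refine Finset.prod_congr rfl fun k _ => ?_
  by_cases h : τ k = k
  · have h2 : τ⁻¹ k = k := by rw [Equiv.Perm.inv_eq_iff_eq]; exact h.symm
    have h3 : (τ * σ).symm k = σ.symm k := by
      rw [Equiv.symm_apply_eq, Equiv.Perm.mul_apply, Equiv.apply_symm_apply, h]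
    rw [if_pos h, if_pos h2, h3]
  · have h2 : ¬ τ⁻¹ k = k := by
      rw [Equiv.Perm.inv_eq_iff_eq]; exact fun h' => h h'.symm
    rw [if_neg h, if_neg h2]

theorem cT_real {q μ : ι → ℂ} {u z : ℂ} (hq : ∀ i, starRingEnd ℂ (q i) = q i)
    (hμ : ∀ i, starRingEnd ℂ (μ i) = μ i) (hu : starRingEnd ℂ u = u)
    (hz : starRingEnd ℂ z = z) (τ σ : Equiv.Perm ι) :
    starRingEnd ℂ (cT q μ u z τ σ) = cT q μ u z τ σ := by
  unfold cT
  rw [map_prod]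
  refine Finset.prod_congr rfl fun k _ => ?_
  split_ifs
  · simp only [map_sub, map_mul, map_one, hq, hμ, hu, hz]
  · exact map_one _

def pairEquiv : (Equiv.Perm ι × Equiv.Perm ι) ≃ (Equiv.Perm ι × Equiv.Perm ι) where
  toFun p := (p.1⁻¹, p.1 * p.2)
  invFun p := (p.1⁻¹, p.1 * p.2)
  left_inv p := by ext <;> simp
  right_inv p := by ext <;> simp

theorem bop_eig_real {q μ : ι → ℂ} {u z e : ℂ} (hq : ∀ i, starRingEnd ℂ (q i) = q i)
    (hμ : ∀ i, starRingEnd ℂ (μ i) = μ i) (hu : starRingEnd ℂ u = u)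
    (hz : starRingEnd ℂ z = z) (φ : Equiv.Perm ι → ℂ) (hφ : φ ≠ 0)
    (h : ∀ σ, Bop q μ u z φ σ = e * φ σ) : starRingEnd ℂ e = e := by
  let S : ℂ := ∑ p : Equiv.Perm ι × Equiv.Perm ι,
    ((Equiv.Perm.sign p.1 : ℤ) : ℂ) * φ (p.1 * p.2) * cT q μ u z p.1 p.2 * starRingEnd ℂ (φ p.2)
  have hS : starRingEnd ℂ S = S := by
    change starRingEnd ℂ (∑ p : Equiv.Perm ι × Equiv.Perm ι, _) = S
    rw [map_sum, ← Equiv.sum_comp pairEquiv]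
    refine Finset.sum_congr rfl fun p _ => ?_
    simp only [pairEquiv, Equiv.coe_fn_mk, map_mul, map_intCast, cT_real hq hμ hu hz,
      Complex.conj_conj, cT_symm, inv_mul_cancel_left, Equiv.Perm.sign_inv]
    ring
  let T : ℝ := ∑ σ, Complex.normSq (φ σ)
  have hST : S = e * (T : ℂ) := by
    change (∑ p : Equiv.Perm ι × Equiv.Perm ι, _) = _
    rw [Fintype.sum_prod_type_right]
    simp only [T]
    rw [Complex.ofReal_sum, Finset.mul_sum]
    refine Finset.sum_congr rfl fun σ _ => ?_
    rw [← Finset.sum_mul]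
    have := h σ
    unfold Bop at this
    unfold cT
    rw [this, mul_assoc, Complex.mul_conj]
  have hT : (T : ℂ) ≠ 0 := by
    rw [Complex.ofReal_ne_zero]
    obtain ⟨σ, hσ⟩ := Function.ne_iff.mp hφ
    refine ne_of_gt (Finset.sum_pos' (fun _ _ => Complex.normSq_nonneg _)
      ⟨σ, Finset.mem_univ _, Complex.normSq_pos.mpr hσ⟩)
  rw [hST, map_mul, Complex.conj_ofReal] at hS
  exact mul_right_cancel₀ hT hS

/-- all eigenvalues of `A` are real -/
def RealSpec (A : Matrix ι ι ℂ) : Prop :=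
  ∀ x : ℂ, (x • (1 : Matrix ι ι ℂ) - A).det = 0 → starRingEnd ℂ x = x

theorem form_real {Q Z : Matrix ι ι ℂ} {v w : ι → ℂ} (h : IsCM Q Z v w)
    (hQ : RealSpec Q) (hZ : RealSpec Z) {u z : ℂ} (hu : starRingEnd ℂ u = u)
    (hz : starRingEnd ℂ z = z) (hdu : (u • (1 : Matrix ι ι ℂ) - Q).det ≠ 0)
    (hdz : (z • (1 : Matrix ι ι ℂ) - Z).det ≠ 0) :
    starRingEnd ℂ (w ⬝ᵥ ((u • 1 - Q)⁻¹ * (z • 1 - Z)⁻¹) *ᵥ v)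
      = w ⬝ᵥ ((u • 1 - Q)⁻¹ * (z • 1 - Z)⁻¹) *ᵥ v := by
  obtain ⟨q, μ, φ, hφ, hq, hμ, hB⟩ := cm_hasP h
  have hq' : ∀ i, starRingEnd ℂ (q i) = q i := fun i => hQ _ (hq i)
  have hμ' : ∀ i, starRingEnd ℂ (μ i) = μ i := fun i => hZ _ (hμ i)
  have hφ0 : φ ≠ 0 := by
    rintro rfl
    simp at hφ
  have he := bop_eig_real hq' hμ' hu hz φ hφ0 (hB u z hdu hdz)
  set x := w ⬝ᵥ ((u • 1 - Q)⁻¹ * (z • 1 - Z)⁻¹) *ᵥ v with hx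
  set d : ℂ := ((-1) ^ Fintype.card ι * ∏ i, (z - μ i)) * ∏ j, (u - q j) with hd
  have hdr : starRingEnd ℂ d = d := by
    rw [hd]
    simp only [map_mul, map_pow, map_neg, map_one, map_prod, map_sub, hq', hμ', hu, hz]
  have hd0 : d ≠ 0 := by
    refine mul_ne_zero (mul_ne_zero (by simp) ?_) ?_
    · rw [Finset.prod_ne_zero_iff]
      intro i _ h0
      rw [sub_eq_zero.mp h0] at hdz
      exact hdz (hμ i)
    · rw [Finset.prod_ne_zero_iff]
      intro i _ h0
      rw [sub_eq_zero.mp h0] at hdu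
      exact hdu (hq i)
  rw [map_mul, hdr] at he
  have := mul_left_cancel₀ hd0 he
  rw [map_sub, map_one] at this
  exact sub_right_injective this

open Filter Topology

theorem tendsto_one_sub (A : Matrix ι ι ℂ) :
    Tendsto (fun t : ℝ => (1 : Matrix ι ι ℂ) - ((t : ℂ)⁻¹) • A) atTop (𝓝 1) := by
  have h0 : Tendsto (fun t : ℝ => ((t : ℂ)⁻¹)) atTop (𝓝 0) := by
    have := (Complex.continuous_ofReal.tendsto 0).comp tendsto_inv_atTop_zero
    simpa [Function.comp_def] using this
  have := (tendsto_const_nhds (x := (1 : Matrix ι ι ℂ))).sub (h0.smul_const A)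
  simpa using this

theorem resolvent_eq (A : Matrix ι ι ℂ) {u : ℂ} (hu : u ≠ 0) :
    u • (1 : Matrix ι ι ℂ) - A = u • (1 - u⁻¹ • A) := by
  rw [smul_sub, smul_smul, mul_inv_cancel₀ hu, one_smul]

theorem eventually_det_ne (A : Matrix ι ι ℂ) :
    ∀ᶠ t : ℝ in atTop, ((t : ℂ) • (1 : Matrix ι ι ℂ) - A).det ≠ 0 := by
  have h1 : Tendsto (fun t : ℝ => ((1 : Matrix ι ι ℂ) - ((t : ℂ)⁻¹) • A).det) atTop (𝓝 1) := by
    have := ((Continuous.matrix_det continuous_id).tendsto (1 : Matrix ι ι ℂ)).comp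
      (tendsto_one_sub A)
    simpa [Function.comp_def] using this
  filter_upwards [h1.eventually_ne one_ne_zero, eventually_gt_atTop 0] with t ht ht0
  have hu : (t : ℂ) ≠ 0 := by exact_mod_cast ht0.ne'
  rw [resolvent_eq A hu, Matrix.det_smul]
  exact mul_ne_zero (pow_ne_zero _ hu) ht

theorem tendsto_smul_resolvent (A : Matrix ι ι ℂ) :
    Tendsto (fun t : ℝ => (t : ℂ) • ((t : ℂ) • (1 : Matrix ι ι ℂ) - A)⁻¹) atTop (𝓝 1) := by
  have h1 := tendsto_matrix_inv (tendsto_one_sub A) (by simp)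
  rw [inv_one] at h1
  refine h1.congr' ?_
  filter_upwards [eventually_gt_atTop 0, eventually_det_ne A] with t ht0 hd
  have hu : (t : ℂ) ≠ 0 := by exact_mod_cast ht0.ne'
  apply Matrix.inv_eq_left_inv
  have h2 : (1 : Matrix ι ι ℂ) - ((t : ℂ)⁻¹) • A = (t : ℂ)⁻¹ • ((t : ℂ) • 1 - A) := by
    rw [resolvent_eq A hu, smul_smul, inv_mul_cancel₀ hu, one_smul]
  rw [h2, Matrix.smul_mul, Matrix.mul_smul, smul_smul, mul_inv_cancel₀ hu, one_smul,
    Matrix.nonsing_inv_mul _ (isUnit_iff_ne_zero.mpr hd)]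

theorem moment_real (A : Matrix ι ι ℂ) (x : ι → ℂ) (a : ℕ) : ∀ (y : ι → ℂ),
    (∀ᶠ t : ℝ in atTop, starRingEnd ℂ (x ⬝ᵥ ((t : ℂ) • (1 : Matrix ι ι ℂ) - A)⁻¹ *ᵥ y)
      = x ⬝ᵥ ((t : ℂ) • (1 : Matrix ι ι ℂ) - A)⁻¹ *ᵥ y) →
    starRingEnd ℂ (x ⬝ᵥ (A ^ a) *ᵥ y) = x ⬝ᵥ (A ^ a) *ᵥ y := by
  have key : ∀ (y : ι → ℂ),
    (∀ᶠ t : ℝ in atTop, starRingEnd ℂ (x ⬝ᵥ ((t : ℂ) • (1 : Matrix ι ι ℂ) - A)⁻¹ *ᵥ y)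
      = x ⬝ᵥ ((t : ℂ) • (1 : Matrix ι ι ℂ) - A)⁻¹ *ᵥ y) →
    starRingEnd ℂ (x ⬝ᵥ y) = x ⬝ᵥ y := by
    intro y hy
    have hc : Continuous (fun M : Matrix ι ι ℂ => x ⬝ᵥ M *ᵥ y) :=
      continuous_const.dotProduct (continuous_id.matrix_mulVec continuous_const)
    have h1 := (hc.tendsto 1).comp (tendsto_smul_resolvent A)
    rw [Matrix.one_mulVec] at h1
    have h2 := (Complex.continuous_conj.tendsto _).comp h1
    refine tendsto_nhds_unique (h2.congr' ?_) h1
    filter_upwards [hy] with t ht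
    simp only [Function.comp_apply, Matrix.smul_mulVec, dotProduct_smul, smul_eq_mul, map_mul,
      Complex.conj_ofReal, ht]
  induction a with
  | zero => intro y hy; rw [pow_zero, Matrix.one_mulVec]; exact key y hy
  | succ a ih =>
    intro y hy
    rw [pow_succ, ← Matrix.mulVec_mulVec]
    apply ih
    have h0 := key y hy
    filter_upwards [hy, eventually_det_ne A] with t ht hd
    have e : ((t : ℂ) • (1 : Matrix ι ι ℂ) - A)⁻¹ *ᵥ (A *ᵥ y)
        = (t : ℂ) • (((t : ℂ) • (1 : Matrix ι ι ℂ) - A)⁻¹ *ᵥ y) - y := by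
      have e1 : A = (t : ℂ) • (1 : Matrix ι ι ℂ) - ((t : ℂ) • (1 : Matrix ι ι ℂ) - A) := by abel
      have e2 : ((t : ℂ) • (1 : Matrix ι ι ℂ) - A)⁻¹ * A
          = (t : ℂ) • ((t : ℂ) • (1 : Matrix ι ι ℂ) - A)⁻¹ - 1 := by
        conv_lhs => rw [show ((t : ℂ) • (1 : Matrix ι ι ℂ) - A)⁻¹ * A
          = ((t : ℂ) • (1 : Matrix ι ι ℂ) - A)⁻¹ * ((t : ℂ) • (1 : Matrix ι ι ℂ) - ((t : ℂ) • (1 : Matrix ι ι ℂ) - A)) by rw [← e1]]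
        rw [Matrix.mul_sub, Matrix.nonsing_inv_mul _ (isUnit_iff_ne_zero.mpr hd), Matrix.mul_smul,
          Matrix.mul_one]
      rw [Matrix.mulVec_mulVec, e2, Matrix.sub_mulVec, Matrix.one_mulVec, Matrix.smul_mulVec]
    rw [e, dotProduct_sub, dotProduct_smul, smul_eq_mul, map_sub, map_mul, ht, h0,
      Complex.conj_ofReal]

theorem pow_form_real {Q Z : Matrix ι ι ℂ} {v w : ι → ℂ} (h : IsCM Q Z v w)
    (hQ : RealSpec Q) (hZ : RealSpec Z) (a b : ℕ) :
    starRingEnd ℂ (w ⬝ᵥ (Q ^ a * Z ^ b) *ᵥ v) = w ⬝ᵥ (Q ^ a * Z ^ b) *ᵥ v := by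
  rw [← Matrix.mulVec_mulVec, dotProduct_mulVec]
  apply moment_real
  filter_upwards [eventually_det_ne Z] with z hz
  rw [← dotProduct_mulVec]
  apply moment_real
  filter_upwards [eventually_det_ne Q] with u hu
  rw [Matrix.mulVec_mulVec]
  exact form_real h hQ hZ (Complex.conj_ofReal _) (Complex.conj_ofReal _) hu hz


noncomputable def wd (Q Z : Matrix ι ι ℂ) (l : List Bool) : Matrix ι ι ℂ :=
  (l.map fun b => if b then Q else Z).prod

theorem wd_append (Q Z : Matrix ι ι ℂ) (l m : List Bool) :
    wd Q Z (l ++ m) = wd Q Z l * wd Q Z m := by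
  simp [wd]

theorem wd_cons (Q Z : Matrix ι ι ℂ) (b : Bool) (l : List Bool) :
    wd Q Z (b :: l) = (if b then Q else Z) * wd Q Z l := by
  simp [wd]

def WR (Q Z : Matrix ι ι ℂ) (v w : ι → ℂ) (l : List Bool) : Prop :=
  starRingEnd ℂ (w ⬝ᵥ (wd Q Z l) *ᵥ v) = w ⬝ᵥ (wd Q Z l) *ᵥ v

theorem word_swap {Q Z : Matrix ι ι ℂ} {v w : ι → ℂ} (h : IsCM Q Z v w) (p m : List Bool) :
    w ⬝ᵥ (wd Q Z (p ++ true :: false :: m)) *ᵥ v - w ⬝ᵥ (wd Q Z (p ++ false :: true :: m)) *ᵥ v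
      = w ⬝ᵥ (wd Q Z (p ++ m)) *ᵥ v
        - (w ⬝ᵥ (wd Q Z p) *ᵥ v) * (w ⬝ᵥ (wd Q Z m) *ᵥ v) := by
  have e : wd Q Z (p ++ true :: false :: m) - wd Q Z (p ++ false :: true :: m)
      = wd Q Z (p ++ m) - wd Q Z p * vecMulVec v w * wd Q Z m := by
    have e1 : wd Q Z (p ++ true :: false :: m) - wd Q Z (p ++ false :: true :: m)
        = wd Q Z p * (Q * Z - Z * Q) * wd Q Z m := by
      simp only [wd_append, wd_cons, if_true, Bool.false_eq_true, if_false]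
      noncomm_ring
    rw [e1, show Q * Z - Z * Q = 1 - vecMulVec v w from h, wd_append]
    noncomm_ring
  rw [← dotProduct_sub, ← Matrix.sub_mulVec, e, Matrix.sub_mulVec, dotProduct_sub]
  congr 1
  rw [Matrix.mul_vecMulVec, Matrix.vecMulVec_mul, Matrix.vecMulVec_mulVec]
  simp only [dotProduct_smul, op_smul_eq_smul, smul_eq_mul, ← dotProduct_mulVec]
  ring

theorem word_perm {Q Z : Matrix ι ι ℂ} {v w : ι → ℂ} (h : IsCM Q Z v w) (n : ℕ)
    (ih : ∀ l : List Bool, l.length < n → WR Q Z v w l) {l l' : List Bool} (hl : l.Perm l') :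
    ∀ p : List Bool, (p ++ l).length = n → (WR Q Z v w (p ++ l) ↔ WR Q Z v w (p ++ l')) := by
  induction hl with
  | nil => intro p _; rfl
  | cons x _ ih2 =>
    intro p hp
    have := ih2 (p ++ [x]) (by simpa using hp)
    simpa using this
  | trans h1 _ i1 i2 =>
    intro p hp
    refine (i1 p hp).trans (i2 p ?_)
    rw [← hp, List.length_append, List.length_append, h1.length_eq]
  | swap x y m =>
    intro p hp
    have hlen : p.length + m.length + 2 = n := by
      rw [← hp]; simp; ring
    have r1 := ih (p ++ m) (by simp; omega)
    have r2 := ih p (by omega)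
    have r3 := ih m (by omega)
    have hs := word_swap h p m
    unfold WR at *
    have key : starRingEnd ℂ (w ⬝ᵥ (wd Q Z (p ++ true :: false :: m)) *ᵥ v)
        - starRingEnd ℂ (w ⬝ᵥ (wd Q Z (p ++ false :: true :: m)) *ᵥ v)
        = w ⬝ᵥ (wd Q Z (p ++ true :: false :: m)) *ᵥ v
          - w ⬝ᵥ (wd Q Z (p ++ false :: true :: m)) *ᵥ v := by
      rw [← map_sub, hs, map_sub, map_mul, r1, r2, r3]
    cases x <;> cases y
    · rfl
    · constructor
      · intro h1; rw [h1] at key; exact sub_right_injective key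
      · intro h1; rw [h1] at key; exact sub_left_injective key
    · constructor
      · intro h1; rw [h1] at key; exact sub_left_injective key
      · intro h1; rw [h1] at key; exact sub_right_injective key
    · rfl

theorem word_real {Q Z : Matrix ι ι ℂ} {v w : ι → ℂ} (h : IsCM Q Z v w)
    (hQ : RealSpec Q) (hZ : RealSpec Z) : ∀ (n : ℕ) (l : List Bool), l.length = n →
    WR Q Z v w l := by
  intro n
  induction n using Nat.strong_induction_on with
  | _ n ih =>
    intro l hl
    have hp : l.Perm (List.replicate (l.count true) true ++ List.replicate (l.count false) false) := by
      rw [List.perm_replicate_append_replicate (by simp)]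
      refine ⟨rfl, rfl, ?_⟩
      intro x _
      cases x <;> simp
    have h1 := word_perm h n (fun l hl => ih _ hl l rfl) hp [] (by simpa using hl)
    rw [List.nil_append, List.nil_append] at h1
    rw [h1]
    unfold WR
    rw [wd_append]
    have := pow_form_real h hQ hZ (l.count true) (l.count false)
    simpa [wd] using this

theorem cm_span_top {Q Z : Matrix ι ι ℂ} {v w : ι → ℂ} (h : IsCM Q Z v w) :
    Submodule.span ℂ (Set.range fun l => wd Q Z l *ᵥ v) = ⊤ := by
  set U := Submodule.span ℂ (Set.range fun l => wd Q Z l *ᵥ v) with hU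
  have hinv : ∀ b : Bool, U ≤ U.comap (Matrix.toLin' (if b then Q else Z)) := by
    intro b
    rw [hU, Submodule.span_le]
    rintro _ ⟨l, rfl⟩
    apply Submodule.subset_span
    refine ⟨b :: l, ?_⟩
    simp [wd_cons, Matrix.mulVec_mulVec]
  have hv : v ∈ U := Submodule.subset_span ⟨[], by simp [wd]⟩
  have hQ : U ≤ U.comap (Matrix.toLin' Q) := by simpa using hinv true
  have hZ : U ≤ U.comap (Matrix.toLin' Z) := by simpa using hinv false
  let Q' := U.mapQ U (Matrix.toLin' Q) hQ
  let Z' := U.mapQ U (Matrix.toLin' Z) hZ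
  have e : Q' * Z' - Z' * Q' = 1 := by
    refine LinearMap.ext fun x => ?_
    obtain ⟨x, rfl⟩ := U.mkQ_surjective x
    have e1 : (Q' * Z' - Z' * Q') (U.mkQ x) = U.mkQ (Q *ᵥ (Z *ᵥ x) - Z *ᵥ (Q *ᵥ x)) := by
      simp [Q', Z', Submodule.mapQ_apply]
    rw [e1, Matrix.mulVec_mulVec, Matrix.mulVec_mulVec, ← Matrix.sub_mulVec,
      show Q * Z - Z * Q = 1 - vecMulVec v w from h, Matrix.sub_mulVec, Matrix.one_mulVec,
      Matrix.vecMulVec_mulVec, map_sub, Module.End.one_apply, sub_eq_self,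
      op_smul_eq_smul, map_smul]
    rw [show U.mkQ v = 0 by simpa using hv, smul_zero]
  have ht := congrArg (LinearMap.trace ℂ _) e
  rw [map_sub, LinearMap.trace_mul_comm, sub_self, LinearMap.trace_one] at ht
  have h0 : Module.finrank ℂ ((ι → ℂ) ⧸ U) = 0 := by exact_mod_cast ht.symm
  have := Module.finrank_zero_iff.mp h0
  exact Submodule.Quotient.subsingleton_iff.mp this

theorem exists_cols {N : ℕ} (s : Set (Fin N → ℂ)) (hs : Submodule.span ℂ s = ⊤) :
    ∃ f : Fin N → Fin N → ℂ, (∀ i, f i ∈ s) ∧ IsUnit (Matrix.of f) := by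
  have := Submodule.exists_fun_fin_finrank_span_eq ℂ s
  rw [hs, finrank_top, Module.finrank_fin_fun] at this
  obtain ⟨f, h1, _, h3⟩ := this
  exact ⟨f, h1, Matrix.linearIndependent_rows_iff_isUnit.mp h3⟩

theorem wd_transpose (Q Z : Matrix ι ι ℂ) (l : List Bool) :
    (wd Zᵀ Qᵀ l)ᵀ = wd Q Z ((l.map (fun b => !b)).reverse) := by
  induction l with
  | nil => simp [wd]
  | cons b l ih =>
    rw [wd_cons, Matrix.transpose_mul, ih, List.map_cons, List.reverse_cons, wd_append]
    congr 1
    cases b <;> simp [wd]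

theorem cm_main {N : ℕ} {Q Z : Matrix (Fin N) (Fin N) ℂ} {v w : Fin N → ℂ} (h : IsCM Q Z v w)
    (hQ : RealSpec Q) (hZ : RealSpec Z) :
    ∃ C : Matrix (Fin N) (Fin N) ℂ, IsUnit C.det ∧
      (∀ i j, ∃ r : ℝ, (C⁻¹ * Q * C) i j = (r : ℂ)) ∧
      (∀ i j, ∃ r : ℝ, (C⁻¹ * Z * C) i j = (r : ℂ)) := by
  have h' : IsCM Zᵀ Qᵀ w v := by
    have := congrArg Matrix.transpose h
    unfold IsCM
    rw [Matrix.transpose_sub, Matrix.transpose_sub, Matrix.transpose_mul, Matrix.transpose_mul,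
      Matrix.transpose_one, Matrix.transpose_vecMulVec] at this
    exact this
  obtain ⟨f, hf, hfu⟩ := exists_cols _ (cm_span_top h)
  obtain ⟨g, hg, hgu⟩ := exists_cols _ (cm_span_top h')
  choose lf hlf using hf
  choose lg hlg using hg
  set D : Matrix (Fin N) (Fin N) ℂ := Matrix.of g with hD
  set C : Matrix (Fin N) (Fin N) ℂ := (Matrix.of f)ᵀ with hC
  have hCu : IsUnit C.det := by
    rw [hC, Matrix.det_transpose]; exact (Matrix.isUnit_iff_isUnit_det _).mp hfu
  have hDu : IsUnit D.det := (Matrix.isUnit_iff_isUnit_det _).mp hgu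
  have real : ∀ m : List Bool, (D * wd Q Z m * C).map (starRingEnd ℂ) = D * wd Q Z m * C := by
    intro m
    ext i j
    have e : (D * wd Q Z m * C) i j
        = w ⬝ᵥ wd Q Z (((lg i).map (fun b => !b)).reverse ++ (m ++ lf j)) *ᵥ v := by
      rw [wd_append, wd_append, ← Matrix.mulVec_mulVec, ← Matrix.mulVec_mulVec,
        show wd Q Z (lf j) *ᵥ v = f j from hlf j, ← wd_transpose, dotProduct_mulVec,
        Matrix.vecMul_transpose, show wd Zᵀ Qᵀ (lg i) *ᵥ w = g i from hlg i, Matrix.mul_assoc,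
        Matrix.mul_apply_eq_vecMul]
      rfl
    rw [Matrix.map_apply, e]
    exact word_real h hQ hZ _ _ rfl
  have hDC : (D * C).map (starRingEnd ℂ) = D * C := by
    have := real []
    simpa [wd] using this
  have concl : ∀ A : Matrix (Fin N) (Fin N) ℂ, (D * A * C).map (starRingEnd ℂ) = D * A * C →
      ∀ i j, ∃ r : ℝ, (C⁻¹ * A * C) i j = (r : ℂ) := by
    intro A hA i j
    rw [← star_real_iff]
    have e1 : (D * C) * (C⁻¹ * A * C) = D * A * C := by
      rw [Matrix.mul_assoc C⁻¹, ← Matrix.mul_assoc (D * C), Matrix.mul_nonsing_inv_cancel_right _ _ hCu,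
        Matrix.mul_assoc]
    have e2 : (D * C) * (C⁻¹ * A * C).map (starRingEnd ℂ) = D * A * C := by
      rw [← hA, ← e1, Matrix.map_mul (L := D * C), hDC]
    have hu : IsUnit (D * C).det := by rw [Matrix.det_mul]; exact hDu.mul hCu
    have e3 := congrArg (fun M => (D * C)⁻¹ * M) (e2.trans e1.symm)
    simp only [Matrix.nonsing_inv_mul_cancel_left _ _ hu] at e3
    exact congrFun (congrFun e3 i) j
  refine ⟨C, hCu, concl Q ?_, concl Z ?_⟩
  · have := real [true]
    simpa [wd] using this
  · have := real [false]
    simpa [wd] using this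

theorem realSpec_of_charpoly {A : Matrix ι ι ℂ}
    (h : ∀ μ : ℂ, (Matrix.charpoly A).IsRoot μ → ∃ r : ℝ, μ = (r : ℂ)) : RealSpec A := by
  intro x hx
  rw [star_real_iff]
  apply h
  rw [Polynomial.IsRoot, Matrix.eval_charpoly, ← hx, Matrix.scalar_apply, Matrix.smul_one_eq_diagonal]

theorem rank_one_form {K : Matrix ι ι ℂ} (hK : K.rank = 1) : ∃ v w, K = vecMulVec v w := by
  rw [Matrix.rank, finrank_eq_one_iff'] at hK
  obtain ⟨v, _, hv⟩ := hK
  have : ∀ j, ∃ c : ℂ, c • (v : ι → ℂ) = K *ᵥ (Pi.single j 1) := by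
    intro j
    obtain ⟨c, hc⟩ := hv ⟨K *ᵥ (Pi.single j 1), ⟨Pi.single j 1, rfl⟩⟩
    exact ⟨c, congrArg Subtype.val hc⟩
  choose w hw using this
  refine ⟨v, w, ?_⟩
  ext i j
  have := congrFun (hw j) i
  rw [Matrix.mulVec_single_one] at this
  rw [vecMulVec_apply, mul_comm]
  exact this.symm

end CM

/-- If `Q` and `Z` are complex `N×N` matrices with `[Q,Z] = 1 - K` for a rank-one
matrix `K`, and all eigenvalues of `Q` and of `Z` are real, then there exists an
invertible complex matrix `C` such that `C⁻¹QC` and `C⁻¹ZC` both have real entries. -/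
theorem stmt_1 (N : ℕ) (hN : 1 ≤ N) (Q Z K : Matrix (Fin N) (Fin N) ℂ)
    (hK : K.rank = 1)
    (hcomm : Q * Z - Z * Q = 1 - K)
    (hQeig : ∀ μ : ℂ, (Matrix.charpoly Q).IsRoot μ → ∃ r : ℝ, μ = (r : ℂ))
    (hZeig : ∀ μ : ℂ, (Matrix.charpoly Z).IsRoot μ → ∃ r : ℝ, μ = (r : ℂ)) :
    ∃ C : Matrix (Fin N) (Fin N) ℂ, IsUnit C.det ∧
      (∀ i j, ∃ r : ℝ, (C⁻¹ * Q * C) i j = (r : ℂ)) ∧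
      (∀ i j, ∃ r : ℝ, (C⁻¹ * Z * C) i j = (r : ℂ)) := by
  obtain ⟨v, w, rfl⟩ := CM.rank_one_form hK
  exact CM.cm_main hcomm (CM.realSpec_of_charpoly hQeig) (CM.realSpec_of_charpoly hZeig)
end
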